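/- arXiv:2307.03064 — 6 statements merged into one kernel-verified Lean document; each statement's English description precedes it below -/
import Mathlib

section
/- Let A and B be n×n positive semidefinite complex matrices and p ≥ 1 a real number. Then Tr((ABA)^p) ≤ Tr(A^p B^p A^p) (the Araki–Lieb–Thirring trace inequality). -/
open Matrix ComplexOrder

/-- The entire function `z ↦ x ^ z` for `x ≠ 0`, extended by `0` at the base `x = 0`. -/
noncomputable def supportCpow (x : ℝ) (z : ℂ) : ℂ :=
  if x = 0 then 0 else Complex.exp (z * (Real.log x : ℂ))

lemma supportCpow_add (x : ℝ) (z w : ℂ) :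
    supportCpow x (z + w) = supportCpow x z * supportCpow x w := by
  unfold supportCpow
  split_ifs
  · simp
  · rw [add_mul, Complex.exp_add]

lemma star_supportCpow (x : ℝ) (z : ℂ) :
    star (supportCpow x z) = supportCpow x (star z) := by
  unfold supportCpow
  split_ifs
  · simp
  · simp [← Complex.exp_conj]

lemma differentiable_supportCpow (x : ℝ) : Differentiable ℂ (supportCpow x) := by
  unfold supportCpow
  split_ifs
  · exact differentiable_const 0
  · fun_prop

lemma norm_supportCpow_le (x : ℝ) (z : ℂ) :
    ‖supportCpow x z‖ ≤ Real.exp (|z.re| * |Real.log x|) := by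
  unfold supportCpow
  split_ifs
  · simpa using Real.exp_nonneg _
  · rw [Complex.norm_exp, Complex.re_mul_ofReal, ← abs_mul]
    exact Real.exp_le_exp.mpr (le_abs_self _)

lemma norm_supportCpow_of_nonneg {x : ℝ} (hx : 0 ≤ x) {z : ℂ} (hz : z.re ≠ 0) :
    ‖supportCpow x z‖ = x ^ z.re := by
  unfold supportCpow
  split_ifs with h
  · simp [h, Real.zero_rpow hz]
  · rw [Complex.norm_exp, Complex.re_mul_ofReal,
      Real.rpow_def_of_pos (lt_of_le_of_ne hx (Ne.symm h)), mul_comm]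

lemma supportCpow_ofReal {x : ℝ} (hx : 0 ≤ x) {r : ℝ} (hr : r ≠ 0) :
    supportCpow x (r : ℂ) = ((x ^ r : ℝ) : ℂ) := by
  unfold supportCpow
  split_ifs with h
  · simp [h, Real.zero_rpow hr]
  · rw [Real.rpow_def_of_pos (lt_of_le_of_ne hx (Ne.symm h)), mul_comm]
    push_cast
    rfl

namespace Matrix

lemma trace_mul_conjTranspose_eq_sum_norm_sq {m n : Type*} [Fintype m] [Fintype n]
    (M : Matrix n m ℂ) :
    (M * Mᴴ).trace = ((∑ x : n × m, ‖M x.1 x.2‖ ^ 2 : ℝ) : ℂ) := by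
  simp only [trace, diag_apply, Matrix.mul_apply, conjTranspose_apply, Fintype.sum_prod_type]
  push_cast
  refine Finset.sum_congr rfl fun i _ => Finset.sum_congr rfl fun j _ => ?_
  exact Complex.mul_conj' _

lemma norm_trace_mul_le_sqrt {m n : Type*} [Fintype m] [Fintype n]
    (F : Matrix n m ℂ) (G : Matrix m n ℂ)
    {s t : ℝ} (hF : (F * Fᴴ).trace = s) (hG : (Gᴴ * G).trace = t) :
    ‖(F * G).trace‖ ≤ √(s * t) := by
  rw [trace_mul_conjTranspose_eq_sum_norm_sq, Complex.ofReal_inj] at hF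
  rw [trace_mul_comm, trace_mul_conjTranspose_eq_sum_norm_sq, Complex.ofReal_inj] at hG
  have hG' : ∑ x : n × m, ‖G x.2 x.1‖ ^ 2 = t := by
    rw [← hG]
    exact Fintype.sum_equiv (Equiv.prodComm n m) _ _ fun _ => rfl
  apply Real.le_sqrt_of_sq_le
  rw [← hF, ← hG']
  refine le_trans ?_ (Finset.sum_mul_sq_le_sq_mul_sq _ _ _)
  gcongr
  simp only [trace, diag_apply, Matrix.mul_apply, Fintype.sum_prod_type]
  refine (norm_sum_le _ _).trans (Finset.sum_le_sum fun i _ => ?_)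
  exact (norm_sum_le _ _).trans (Finset.sum_le_sum fun j _ => (norm_mul _ _).le)

variable {n : Type*} [Fintype n] [DecidableEq n]

/-- Complex powers of a Hermitian matrix, restricted to the complement of its kernel. -/
noncomputable def IsHermitian.supportCpow {A : Matrix n n ℂ} (hA : A.IsHermitian) (z : ℂ) :
    Matrix n n ℂ :=
  (hA.eigenvectorUnitary : Matrix n n ℂ) *
    diagonal (fun i => _root_.supportCpow (hA.eigenvalues i) z) *
    star (hA.eigenvectorUnitary : Matrix n n ℂ)

section algebra

variable {A : Matrix n n ℂ} (hA : A.IsHermitian)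

lemma IsHermitian.supportCpow_mul (z w : ℂ) :
    hA.supportCpow z * hA.supportCpow w = hA.supportCpow (z + w) := by
  have h : star (hA.eigenvectorUnitary : Matrix n n ℂ) *
      (hA.eigenvectorUnitary : Matrix n n ℂ) = 1 := Unitary.coe_star_mul_self _
  simp only [IsHermitian.supportCpow, supportCpow_add, ← diagonal_mul_diagonal]
  calc _ = (hA.eigenvectorUnitary : Matrix n n ℂ) *
        diagonal (fun i => _root_.supportCpow (hA.eigenvalues i) z) *
        (star (hA.eigenvectorUnitary : Matrix n n ℂ) * (hA.eigenvectorUnitary : Matrix n n ℂ)) *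
        diagonal (fun i => _root_.supportCpow (hA.eigenvalues i) w) *
        star (hA.eigenvectorUnitary : Matrix n n ℂ) := by simp only [Matrix.mul_assoc]
    _ = _ := by rw [h]; simp only [Matrix.mul_assoc, Matrix.one_mul]

lemma IsHermitian.conjTranspose_supportCpow (z : ℂ) :
    (hA.supportCpow z)ᴴ = hA.supportCpow (star z) := by
  simp only [IsHermitian.supportCpow, conjTranspose_mul, star_eq_conjTranspose,
    conjTranspose_conjTranspose, diagonal_conjTranspose, Matrix.mul_assoc]
  congr
  ext i
  exact star_supportCpow _ _

lemma IsHermitian.differentiable_supportCpow_apply (i j : n) :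
    Differentiable ℂ (fun z => hA.supportCpow z i j) := by
  simp only [IsHermitian.supportCpow, Matrix.mul_apply, diagonal_apply]
  refine Differentiable.fun_sum fun k _ => Differentiable.mul_const ?_ _
  refine Differentiable.fun_sum fun l _ => Differentiable.const_mul ?_ _
  split_ifs
  · exact differentiable_supportCpow _
  · exact differentiable_const 0

lemma PosSemidef.cfc_rpow_eq_supportCpow (hA : A.PosSemidef) {r : ℝ} (hr : r ≠ 0) :
    cfc (fun x : ℝ => x ^ r) A = hA.isHermitian.supportCpow r := by
  rw [hA.isHermitian.cfc_eq, IsHermitian.cfc, Unitary.conjStarAlgAut_apply,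
    IsHermitian.supportCpow]
  congr
  ext i
  simp [supportCpow_ofReal (hA.eigenvalues_nonneg i) hr]

lemma PosSemidef.supportCpow_one (hA : A.PosSemidef) : hA.isHermitian.supportCpow 1 = A := by
  have h := hA.cfc_rpow_eq_supportCpow one_ne_zero
  simp only [Real.rpow_one, Complex.ofReal_one] at h
  rw [← h]
  exact cfc_id' ℝ A hA.isHermitian.isSelfAdjoint

lemma IsHermitian.trace_supportCpow (z : ℂ) :
    (hA.supportCpow z).trace = ∑ i, _root_.supportCpow (hA.eigenvalues i) z := by
  have h : star (hA.eigenvectorUnitary : Matrix n n ℂ) *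
      (hA.eigenvectorUnitary : Matrix n n ℂ) = 1 := Unitary.coe_star_mul_self _
  rw [IsHermitian.supportCpow, trace_mul_comm, ← Matrix.mul_assoc, h, Matrix.one_mul,
    trace_diagonal]

end algebra

open scoped Matrix.Norms.L2Operator

lemma norm_apply_self_le_l2_opNorm (M : Matrix n n ℂ) (i : n) : ‖M i i‖ ≤ ‖M‖ := by
  have h : M i i = inner ℂ (EuclideanSpace.single i (1 : ℂ))
      (toEuclideanCLM (n := n) (𝕜 := ℂ) M (EuclideanSpace.single i 1)) := by
    simp [EuclideanSpace.inner_single_left]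
  rw [h, cstar_norm_def]
  refine (norm_inner_le_norm _ _).trans ?_
  simpa using (toEuclideanCLM (n := n) (𝕜 := ℂ) M).le_opNorm (EuclideanSpace.single i 1)

lemma norm_trace_le_card_mul_l2_opNorm (M : Matrix n n ℂ) :
    ‖M.trace‖ ≤ Fintype.card n * ‖M‖ := by
  refine (norm_sum_le _ _).trans ?_
  refine (Finset.sum_le_sum fun i _ => M.norm_apply_self_le_l2_opNorm i).trans ?_
  simp

lemma IsHermitian.norm_trace_mul_supportCpow_le {A : Matrix n n ℂ} (hA : A.IsHermitian)
    {M : Matrix n n ℂ} (hM : ‖M‖ ≤ 1) (z : ℂ) :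
    ‖(M * hA.supportCpow z).trace‖ ≤ ∑ i, ‖_root_.supportCpow (hA.eigenvalues i) z‖ := by
  set U := hA.eigenvectorUnitary
  have h : (M * hA.supportCpow z).trace = ((star (U : Matrix n n ℂ) * M * U) *
      diagonal (fun i => _root_.supportCpow (hA.eigenvalues i) z)).trace := by
    rw [IsHermitian.supportCpow, ← Matrix.mul_assoc, trace_mul_comm]
    simp only [Matrix.mul_assoc, U]
  have hU : ‖star (U : Matrix n n ℂ) * M * U‖ ≤ 1 := by
    rw [CStarRing.norm_mul_coe_unitary, ← Unitary.coe_star, CStarRing.norm_coe_unitary_mul]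
    exact hM
  rw [h]
  refine (norm_sum_le _ _).trans (Finset.sum_le_sum fun i _ => ?_)
  rw [diag_apply, mul_diagonal, norm_mul]
  exact mul_le_of_le_one_left (norm_nonneg _)
    ((norm_apply_self_le_l2_opNorm _ i).trans hU)

lemma IsHermitian.l2_opNorm_supportCpow {A : Matrix n n ℂ} (hA : A.IsHermitian) (z : ℂ) :
    ‖hA.supportCpow z‖ = ‖fun i => _root_.supportCpow (hA.eigenvalues i) z‖ := by
  rw [IsHermitian.supportCpow, ← Unitary.coe_star, CStarRing.norm_mul_coe_unitary,
    CStarRing.norm_coe_unitary_mul, l2_opNorm_diagonal]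

lemma IsHermitian.l2_opNorm_supportCpow_le_one {A : Matrix n n ℂ} (hA : A.IsHermitian) {z : ℂ}
    (hz : z.re = 0) : ‖hA.supportCpow z‖ ≤ 1 := by
  rw [hA.l2_opNorm_supportCpow, pi_norm_le_iff_of_nonneg zero_le_one]
  intro i
  simpa [hz] using norm_supportCpow_le (hA.eigenvalues i) z

lemma IsHermitian.exists_l2_opNorm_supportCpow_le {A : Matrix n n ℂ} (hA : A.IsHermitian)
    (c : ℝ) : ∃ C, ∀ z : ℂ, |z.re| ≤ c → ‖hA.supportCpow z‖ ≤ C := by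
  refine ⟨∑ i, Real.exp (c * |Real.log (hA.eigenvalues i)|), fun z hz => ?_⟩
  rw [hA.l2_opNorm_supportCpow, pi_norm_le_iff_of_nonneg (by positivity)]
  intro i
  refine (norm_supportCpow_le _ _).trans ?_
  refine le_trans ?_ (Finset.single_le_sum
    (f := fun i => Real.exp (c * |Real.log (hA.eigenvalues i)|)) (fun _ _ => (Real.exp_pos _).le)
    (Finset.mem_univ i))
  gcongr

/-- The trace inequality obtained by three-lines interpolation, with `X = A * B ^ (1 / 2)`, of
`z ↦ Tr (A ^ (p z) B ^ (p z / 2) Xᴴ K ^ (p - 1 / 2 - p z / 2))` where `K = X * Xᴴ = A * B * A`. -/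
lemma PosSemidef.trace_supportCpow_mul_mul_le {A B : Matrix n n ℂ} (hA : A.PosSemidef)
    (hB : B.PosSemidef) (hK : (A * B * A).PosSemidef) {p : ℝ} (hp : 1 ≤ p) :
    (hK.isHermitian.supportCpow p).trace ≤
      (hA.isHermitian.supportCpow p * hB.isHermitian.supportCpow p *
        hA.isHermitian.supportCpow p).trace := by
  set P := hA.isHermitian.supportCpow
  set Q := hB.isHermitian.supportCpow
  set R := hK.isHermitian.supportCpow with hR
  have hp0 : 0 < p := by linarith
  obtain ⟨t, ht⟩ : ∃ t : ℝ, t = ∑ i, hK.isHermitian.eigenvalues i ^ p := ⟨_, rfl⟩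
  have ht0 : 0 ≤ t := ht ▸ Finset.sum_nonneg fun i _ =>
    Real.rpow_nonneg (hK.eigenvalues_nonneg i) _
  have htR : (R p).trace = t := by
    rw [hR, IsHermitian.trace_supportCpow, ht]
    push_cast
    exact Finset.sum_congr rfl fun i _ => by
      rw [supportCpow_ofReal (hK.eigenvalues_nonneg i) hp0.ne',
        Complex.ofReal_cpow (hK.eigenvalues_nonneg i)]
  have hPP : ∀ z w, P z * P w = P (z + w) := hA.isHermitian.supportCpow_mul
  have hQQ : ∀ z w, Q z * Q w = Q (z + w) := hB.isHermitian.supportCpow_mul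
  have hRR : ∀ z w, R z * R w = R (z + w) := hK.isHermitian.supportCpow_mul
  have hPs : ∀ z, (P z)ᴴ = P (star z) := hA.isHermitian.conjTranspose_supportCpow
  have hQs : ∀ z, (Q z)ᴴ = Q (star z) := hB.isHermitian.conjTranspose_supportCpow
  have hRs : ∀ z, (R z)ᴴ = R (star z) := hK.isHermitian.conjTranspose_supportCpow
  have hP1 : P 1 = A := hA.supportCpow_one
  have hQ1 : Q 1 = B := hB.supportCpow_one
  have hR1 : R 1 = A * B * A := hK.supportCpow_one
  obtain ⟨Y, hY⟩ : ∃ Y, Y = Q (1 / 2) * A := ⟨_, rfl⟩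
  have hYY : Yᴴ * Y = R 1 := by
    rw [hY, conjTranspose_mul, hA.isHermitian.eq, hQs, hR1, Matrix.mul_assoc,
      ← Matrix.mul_assoc _ _ A, hQQ, ← Matrix.mul_assoc]
    norm_num [hQ1]
  have hYR : ‖Y * R (-(1 / 2))‖ ≤ 1 := by
    have h : ‖Y * R (-(1 / 2))‖ * ‖Y * R (-(1 / 2))‖ ≤ 1 := by
      rw [← CStarRing.norm_star_mul_self, star_eq_conjTranspose, conjTranspose_mul, hRs,
        Matrix.mul_assoc, ← Matrix.mul_assoc Yᴴ, hYY, hRR, hRR]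
      apply IsHermitian.l2_opNorm_supportCpow_le_one
      norm_num
    nlinarith [norm_nonneg (Y * R (-(1 / 2)))]
  obtain ⟨s, hs0, hs⟩ : ∃ s : ℝ, 0 ≤ s ∧ (P p * Q p * P p).trace = s := by
    refine ⟨_, Finset.sum_nonneg fun _ _ => sq_nonneg _,
      Eq.trans ?_ (trace_mul_conjTranspose_eq_sum_norm_sq (P p * Q (p / 2)))⟩
    rw [conjTranspose_mul, hQs, hPs, Matrix.mul_assoc, Matrix.mul_assoc, ← Matrix.mul_assoc (Q _),
      hQQ]
    simp
  set F : ℂ → Matrix n n ℂ := fun z => P (p * z) * Q (p * z / 2) with hF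
  set G : ℂ → Matrix n n ℂ := fun z => Y * R (p - 1 / 2 - p * z / 2) with hG
  have hdiff : Differentiable ℂ fun z => (F z * G z).trace := by
    have hPd : ∀ i j, Differentiable ℂ fun z => P z i j :=
      hA.isHermitian.differentiable_supportCpow_apply
    have hQd : ∀ i j, Differentiable ℂ fun z => Q z i j :=
      hB.isHermitian.differentiable_supportCpow_apply
    have hRd : ∀ i j, Differentiable ℂ fun z => R z i j :=
      hK.isHermitian.differentiable_supportCpow_apply
    have hF' : ∀ i j, Differentiable ℂ fun z => F z i j := fun i j => by
      simp only [hF, Matrix.mul_apply]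
      exact Differentiable.fun_sum fun k _ =>
        ((hPd i k).comp (by fun_prop : Differentiable ℂ fun z : ℂ => (p : ℂ) * z)).mul
          ((hQd k j).comp (by fun_prop : Differentiable ℂ fun z : ℂ => (p : ℂ) * z / 2))
    have hG' : ∀ i j, Differentiable ℂ fun z => G z i j := fun i j => by
      simp only [hG, Matrix.mul_apply]
      exact Differentiable.fun_sum fun k _ => ((hRd k j).comp
        (by fun_prop : Differentiable ℂ fun z : ℂ => (p : ℂ) - 1 / 2 - p * z / 2)).const_mul _
    simp only [trace, diag_apply, Matrix.mul_apply]
    exact Differentiable.fun_sum fun i _ => Differentiable.fun_sum fun j _ =>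
      (hF' i j).mul (hG' j i)
  have hbdd : BddAbove ((norm ∘ fun z => (F z * G z).trace) ''
      Complex.HadamardThreeLines.verticalClosedStrip 0 1) := by
    obtain ⟨CP, hCP⟩ := hA.isHermitian.exists_l2_opNorm_supportCpow_le p
    obtain ⟨CQ, hCQ⟩ := hB.isHermitian.exists_l2_opNorm_supportCpow_le p
    obtain ⟨CR, hCR⟩ := hK.isHermitian.exists_l2_opNorm_supportCpow_le p
    refine ⟨Fintype.card n * (CP * CQ * (‖Y‖ * CR)), ?_⟩
    rintro _ ⟨z, ⟨hz0, hz1⟩, rfl⟩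
    refine (norm_trace_le_card_mul_l2_opNorm _).trans ?_
    have h0 : 0 ≤ p * z.re := by positivity
    have h1 : p * z.re ≤ p := by nlinarith
    have hz2 : |((p : ℂ) * z).re| ≤ p := by
      rw [Complex.re_ofReal_mul, abs_le]
      constructor <;> linarith
    have hz3 : |((p : ℂ) * z / 2).re| ≤ p := by
      rw [Complex.div_ofNat_re, Complex.re_ofReal_mul, abs_le]
      constructor <;> linarith
    have hz4 : |((p : ℂ) - 1 / 2 - p * z / 2).re| ≤ p := by
      have : ((p : ℂ) - 1 / 2 - p * z / 2).re = p - 1 / 2 - p * z.re / 2 := by simp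
      rw [this, abs_le]
      constructor <;> linarith
    have hP' := hCP _ hz2
    have hQ' := hCQ _ hz3
    have hR' := hCR _ hz4
    have hCP0 := (norm_nonneg _).trans hP'
    have hCQ0 := (norm_nonneg _).trans hQ'
    gcongr
    refine (norm_mul_le _ _).trans ?_
    gcongr
    · refine (norm_mul_le _ _).trans ?_
      gcongr
    · refine (norm_mul_le _ _).trans ?_
      gcongr
  have hleft : ∀ z ∈ Complex.re ⁻¹' {0}, ‖(F z * G z).trace‖ ≤ t := by
    intro z hz
    have hz0 : z.re = 0 := hz
    have hsplit : F z * G z =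
        P (p * z) * Q (p * z / 2) * (Y * R (-(1 / 2))) * R (p - p * z / 2) := by
      rw [Matrix.mul_assoc _ (Y * _), Matrix.mul_assoc Y, hRR]
      simp only [hF, hG]
      congr 3
      ring
    have hM : ‖P (p * z) * Q (p * z / 2) * (Y * R (-(1 / 2)))‖ ≤ 1 := by
      have h1 : ‖P (p * z)‖ ≤ 1 :=
        hA.isHermitian.l2_opNorm_supportCpow_le_one (by simp [hz0])
      have h2 : ‖Q (p * z / 2)‖ ≤ 1 :=
        hB.isHermitian.l2_opNorm_supportCpow_le_one (by simp [hz0])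
      refine (norm_mul_le _ _).trans (mul_le_one₀ ?_ (norm_nonneg _) hYR)
      exact (norm_mul_le _ _).trans (mul_le_one₀ h1 (norm_nonneg _) h2)
    rw [hsplit]
    refine (hK.isHermitian.norm_trace_mul_supportCpow_le hM _).trans_eq ?_
    have hre : ((p : ℂ) - p * z / 2).re = p := by simp [hz0]
    rw [ht]
    refine Finset.sum_congr rfl fun i _ => ?_
    rw [norm_supportCpow_of_nonneg (hK.eigenvalues_nonneg i) (by rw [hre]; exact hp0.ne'), hre]
  have hright : ∀ z ∈ Complex.re ⁻¹' {1}, ‖(F z * G z).trace‖ ≤ √(s * t) := by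
    intro z hz
    have hz1 : z.re = 1 := hz
    have hzz : z + star z = 2 := by
      rw [Complex.star_def, Complex.add_conj, hz1]
      norm_num
    apply norm_trace_mul_le_sqrt
    · have h1 : F z * (F z)ᴴ = P (p * z) * Q p * P (p * star z) := by
        simp only [hF, conjTranspose_mul, hPs, hQs]
        rw [Matrix.mul_assoc, ← Matrix.mul_assoc (Q _), hQQ, ← Matrix.mul_assoc]
        congr 3
        · simp only [star_div₀, star_mul', Complex.star_def, Complex.conj_ofReal] at hzz ⊢
          simp only [map_ofNat]
          linear_combination (p / 2 : ℂ) * hzz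
        · simp
      rw [h1, ← hs, trace_mul_cycle, trace_mul_cycle (P p), hPP, hPP]
      congr 3
      linear_combination (p : ℂ) * hzz
    · have h1 : (G z)ᴴ * G z = R p := by
        simp only [hG, conjTranspose_mul, hRs]
        rw [Matrix.mul_assoc, ← Matrix.mul_assoc _ Y, hYY, hRR, hRR]
        congr 1
        simp only [star_sub, star_div₀, star_mul', Complex.star_def, Complex.conj_ofReal,
          map_ofNat, star_one] at hzz ⊢
        linear_combination (-p / 2 : ℂ) * hzz
      rw [h1, htR]
  have hmid : (F ((1 / p : ℝ) : ℂ) * G ((1 / p : ℝ) : ℂ)).trace = t := by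
    have hpz : (p : ℂ) * ((1 / p : ℝ) : ℂ) = 1 := by
      rw [← Complex.ofReal_mul, mul_one_div_cancel hp0.ne', Complex.ofReal_one]
    simp only [hF, hG, hpz, hP1]
    have hAQ : A * Q (1 / 2) = Yᴴ := by
      rw [hY, conjTranspose_mul, hA.isHermitian.eq, hQs]
      norm_num
    rw [hAQ, ← Matrix.mul_assoc, hYY, hRR, ← htR]
    congr 2
    ring
  have hθ0 : 0 < 1 / p := by positivity
  have hθ1 : 1 / p ≤ 1 := by rwa [div_le_one hp0]
  have hint := Complex.HadamardThreeLines.norm_le_interp_of_mem_verticalClosedStrip₀₁'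
    (fun z => (F z * G z).trace) (z := ((1 / p : ℝ) : ℂ)) ⟨hθ0.le, hθ1⟩
    hdiff.diffContOnCl hbdd hleft hright
  rw [hmid, Complex.norm_real, Real.norm_of_nonneg ht0, Complex.ofReal_re] at hint
  rw [htR, hs, Complex.real_le_real]
  rcases ht0.eq_or_lt with h0 | hpos
  · exact h0 ▸ hs0
  have hroot : t ^ (1 / p) ≤ √(s * t) ^ (1 / p) := by
    refine le_of_mul_le_mul_left ?_ (Real.rpow_pos_of_pos hpos (1 - 1 / p))
    rwa [← Real.rpow_add hpos, sub_add_cancel, Real.rpow_one]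
  rw [Real.rpow_le_rpow_iff ht0 (Real.sqrt_nonneg _) hθ0, Real.le_sqrt ht0 (by positivity),
    sq] at hroot
  exact le_of_mul_le_mul_right hroot hpos

end Matrix

/-- **Araki–Lieb–Thirring trace inequality.** If `A, B` are positive semidefinite
`n × n` complex matrices and `p ≥ 1`, then `Tr((ABA)^p) ≤ Tr(A^p B^p A^p)`,
where real powers of positive semidefinite matrices are taken via the
continuous functional calculus. -/
theorem araki_lieb_thirring {n : ℕ} {A B : Matrix (Fin n) (Fin n) ℂ}
    (hA : A.PosSemidef) (hB : B.PosSemidef) {p : ℝ} (hp : 1 ≤ p) :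
    (cfc (fun x : ℝ => x ^ p) (A * B * A)).trace ≤
      (cfc (fun x : ℝ => x ^ p) A * cfc (fun x : ℝ => x ^ p) B *
        cfc (fun x : ℝ => x ^ p) A).trace := by
  have hK : (A * B * A).PosSemidef := by
    simpa [hA.isHermitian.eq] using hB.conjTranspose_mul_mul_same A
  have hp0 : p ≠ 0 := by linarith
  rw [hA.cfc_rpow_eq_supportCpow hp0, hB.cfc_rpow_eq_supportCpow hp0,
    hK.cfc_rpow_eq_supportCpow hp0]
  exact hA.trace_supportCpow_mul_mul_le hB hK hp
end

section
/- If A ≥ B ≥ 0 are positive semidefinite n×n matrices, then A^p ≥ B^p for all p ∈ (0,1) (the Löwner–Heinz inequality). -/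
open Matrix ComplexOrder

/-- **Löwner–Heinz inequality.** If `A ≥ B ≥ 0` in the Loewner order, then
`A^p ≥ B^p` for all `p ∈ (0,1)`, powers via functional calculus. -/
theorem loewner_heinz {n : ℕ} {A B : Matrix (Fin n) (Fin n) ℂ}
    (hB : B.PosSemidef) (hAB : (A - B).PosSemidef) {p : ℝ} (hp0 : 0 < p) (hp1 : p < 1) :
    (cfc (fun x : ℝ => x ^ p) A - cfc (fun x : ℝ => x ^ p) B).PosSemidef := by
  open scoped MatrixOrder Matrix.Norms.L2Operator in
  have hle : B ≤ A := Matrix.le_iff.mpr hAB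
  have hpow : B ^ p ≤ A ^ p := CFC.rpow_le_rpow ⟨hp0.le, hp1.le⟩ hle
  rw [CFC.rpow_eq_cfc_real hB.nonneg, CFC.rpow_eq_cfc_real (hB.nonneg.trans hle)] at hpow
  exact Matrix.le_iff.mp hpow
end

section
/- Let f be a monotone concave function on [0,∞) with f(0) ≥ 0, and let A, B be n×n positive semidefinite matrices. Then there exist unitary matrices U, V such that f(A+B) ≤ U f(A) U* + V f(B) V*. -/
open Matrix ComplexOrder

/-- A Hermitian matrix is diagonalized, simultaneously with all its functions, by a unitary
sorting the eigenvalues in increasing order. -/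
lemma exists_monotone_diagonalization {n : ℕ} {A : Matrix (Fin n) (Fin n) ℂ}
    (hA : A.IsHermitian) :
    ∃ U ∈ Matrix.unitaryGroup (Fin n) ℂ, ∃ d : Fin n → ℝ, Monotone d ∧
      (∀ i, d i ∈ spectrum ℝ A) ∧
      ∀ f : ℝ → ℝ, cfc f A = U * diagonal (fun i => ((f (d i) : ℝ) : ℂ)) * Uᴴ := by
  set σ := Tuple.sort hA.eigenvalues
  set Q : Matrix (Fin n) (Fin n) ℂ := (hA.eigenvectorUnitary : Matrix (Fin n) (Fin n) ℂ)
  have hQu : Qᴴ * Q = 1 := by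
    simpa [star_eq_conjTranspose] using (Matrix.mem_unitaryGroup_iff'.1 hA.eigenvectorUnitary.2)
  refine ⟨Q.submatrix id σ, ?_, hA.eigenvalues ∘ σ, Tuple.monotone_sort _,
    fun i => hA.eigenvalues_mem_spectrum_real _, fun f => ?_⟩
  · rw [Matrix.mem_unitaryGroup_iff', star_eq_conjTranspose, conjTranspose_submatrix,
      ← submatrix_mul _ _ _ _ _ Function.bijective_id, hQu]
    simp
  · rw [hA.cfc_eq, IsHermitian.cfc, Unitary.conjStarAlgAut_apply, conjTranspose_submatrix]
    have : diagonal (fun i => ((f ((hA.eigenvalues ∘ σ) i) : ℝ) : ℂ)) =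
        (diagonal (RCLike.ofReal ∘ f ∘ hA.eigenvalues) : Matrix (Fin n) (Fin n) ℂ).submatrix
          σ σ := by
      ext i j; simp [diagonal_apply]
    rw [this, submatrix_mul_equiv, submatrix_mul_equiv, submatrix_id_id]
    rfl

/-- A Hermitian matrix is diagonalized, simultaneously with all its functions, by a unitary
sorting the eigenvalues in decreasing order. -/
lemma exists_antitone_diagonalization {n : ℕ} {A : Matrix (Fin n) (Fin n) ℂ}
    (hA : A.IsHermitian) :
    ∃ U ∈ Matrix.unitaryGroup (Fin n) ℂ, ∃ d : Fin n → ℝ, Antitone d ∧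
      (∀ i, d i ∈ spectrum ℝ A) ∧
      ∀ f : ℝ → ℝ, cfc f A = U * diagonal (fun i => ((f (d i) : ℝ) : ℂ)) * Uᴴ := by
  obtain ⟨U, hU, d, hd, hs, hf⟩ := exists_monotone_diagonalization hA
  refine ⟨U.submatrix id Fin.revPerm, ?_, d ∘ Fin.revPerm,
    fun i j hij => hd (Fin.rev_le_rev.2 hij), fun i => hs _, fun f => ?_⟩
  · rw [Matrix.mem_unitaryGroup_iff', star_eq_conjTranspose] at hU ⊢
    rw [conjTranspose_submatrix, ← submatrix_mul _ _ _ _ _ Function.bijective_id, hU]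
    simp
  · have : diagonal (fun i => ((f ((d ∘ Fin.revPerm) i) : ℝ) : ℂ)) =
        (diagonal fun i => ((f (d i) : ℝ) : ℂ)).submatrix Fin.revPerm Fin.revPerm := by
      ext i j; simp [diagonal_apply]
    rw [this, conjTranspose_submatrix, submatrix_mul_equiv, submatrix_mul_equiv, submatrix_id_id,
      hf]

lemma sum_normSq_eq_re_dotProduct {n : ℕ} (b : Fin n → ℂ) :
    ∑ i, Complex.normSq (b i) = (star b ⬝ᵥ b).re := by
  simp [dotProduct, Complex.normSq_apply]

lemma sum_normSq_unitary_mulVec {n : ℕ} {U : Matrix (Fin n) (Fin n) ℂ} (hU : Uᴴ * U = 1)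
    (b : Fin n → ℂ) :
    ∑ i, Complex.normSq ((U *ᵥ b) i) = ∑ i, Complex.normSq (b i) := by
  rw [sum_normSq_eq_re_dotProduct, sum_normSq_eq_re_dotProduct, star_mulVec, dotProduct_mulVec,
    vecMul_vecMul, hU, vecMul_one]

lemma star_dotProduct_conj_mulVec {n : ℕ} (X M : Matrix (Fin n) (Fin n) ℂ) (h : Fin n → ℂ) :
    star h ⬝ᵥ (X * M * Xᴴ) *ᵥ h = star (Xᴴ *ᵥ h) ⬝ᵥ M *ᵥ (Xᴴ *ᵥ h) := by
  rw [star_mulVec, conjTranspose_conjTranspose, ← dotProduct_mulVec, mulVec_mulVec,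
    mulVec_mulVec]

lemma re_dotProduct_diagonalization {n : ℕ} (U : Matrix (Fin n) (Fin n) ℂ) (c : Fin n → ℝ)
    (h : Fin n → ℂ) :
    (star h ⬝ᵥ (U * diagonal (fun i => (c i : ℂ)) * Uᴴ) *ᵥ h).re =
      ∑ i, c i * Complex.normSq ((Uᴴ *ᵥ h) i) := by
  rw [star_dotProduct_conj_mulVec]
  simp only [dotProduct, mulVec_diagonal, Complex.re_sum]
  refine Finset.sum_congr rfl fun i _ => ?_
  simp [Complex.normSq_apply]
  ring

/-- A Hermitian matrix whose quadratic form is bounded by `c k` on the span of the columns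
`k, k + 1, …` of a unitary `W`, for each `k`, lies below a unitary conjugate of `diagonal c`. -/
lemma exists_unitary_conj_diagonal_ge {n : ℕ} {M W : Matrix (Fin n) (Fin n) ℂ}
    (hM : M.IsHermitian) (hW : W ∈ Matrix.unitaryGroup (Fin n) ℂ) (c : Fin n → ℝ)
    (hc : ∀ k b, (∀ i < k, b i = 0) →
      (star (W *ᵥ b) ⬝ᵥ M *ᵥ (W *ᵥ b)).re ≤ c k * ∑ i, Complex.normSq (b i)) :
    ∃ Q ∈ Matrix.unitaryGroup (Fin n) ℂ,
      (Q * diagonal (fun i => (c i : ℂ)) * Qᴴ - M).PosSemidef := by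
  obtain ⟨Q, hQ, m, hm, -, hf⟩ := exists_antitone_diagonalization hM
  have hMQ : M = Q * diagonal (fun i => (m i : ℂ)) * Qᴴ := by
    simpa [cfc_id' ℝ M hM.isSelfAdjoint] using hf fun x => x
  rw [Matrix.mem_unitaryGroup_iff', star_eq_conjTranspose] at hW
  have hQ' := Matrix.mem_unitaryGroup_iff.1 hQ
  rw [star_eq_conjTranspose] at hQ'
  have hmc : ∀ k, m k ≤ c k := by
    intro k
    set N : Matrix (Fin n) (Fin n) ℂ := fun i j =>
      if i < k then (1 : Matrix (Fin n) (Fin n) ℂ) i j else if k < i then (Qᴴ * W) i j else 0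
    have hN : N.det = 0 := det_eq_zero_of_row_eq_zero k fun j => by simp [N]
    obtain ⟨b, hb0, hb⟩ := exists_mulVec_eq_zero_iff.2 hN
    have h1 : ∀ i < k, b i = 0 := by
      intro i hi
      have h := congrFun hb i
      have : (N *ᵥ b) i = ((1 : Matrix (Fin n) (Fin n) ℂ) *ᵥ b) i := by
        simp [mulVec, dotProduct, N, hi]
      rw [this] at h
      simpa using h
    have h2 : ∀ i, k < i → (Qᴴ *ᵥ (W *ᵥ b)) i = 0 := by
      intro i hi
      have h := congrFun hb i
      have : (N *ᵥ b) i = ((Qᴴ * W) *ᵥ b) i := by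
        simp [mulVec, dotProduct, N, hi, hi.not_gt]
      rw [this] at h
      simpa using h
    have h3 := hc k b h1
    rw [hMQ, re_dotProduct_diagonalization] at h3
    have h4 : ∑ i, Complex.normSq ((Qᴴ *ᵥ (W *ᵥ b)) i) = ∑ i, Complex.normSq (b i) := by
      rw [sum_normSq_unitary_mulVec (by simpa using hQ'), sum_normSq_unitary_mulVec hW]
    have h5 : m k * ∑ i, Complex.normSq ((Qᴴ *ᵥ (W *ᵥ b)) i) ≤
        ∑ i, m i * Complex.normSq ((Qᴴ *ᵥ (W *ᵥ b)) i) := by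
      rw [Finset.mul_sum]
      refine Finset.sum_le_sum fun i _ => ?_
      rcases le_or_gt i k with hi | hi
      · exact mul_le_mul_of_nonneg_right (hm hi) (Complex.normSq_nonneg _)
      · simp [h2 i hi]
    obtain ⟨j, hj⟩ := Function.ne_iff.1 hb0
    have h6 : 0 < ∑ i, Complex.normSq (b i) :=
      Finset.sum_pos' (fun i _ => Complex.normSq_nonneg _)
        ⟨j, Finset.mem_univ _, Complex.normSq_pos.2 hj⟩
    rw [h4] at h5
    exact le_of_mul_le_mul_right (h5.trans h3) h6
  refine ⟨Q, hQ, ?_⟩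
  have : Q * diagonal (fun i => (c i : ℂ)) * Qᴴ - M =
      Q * diagonal (fun i => ((c i - m i : ℝ) : ℂ)) * Qᴴ := by
    conv_lhs => rw [hMQ]
    rw [← Matrix.sub_mul, ← Matrix.mul_sub, diagonal_sub]
    simp
  rw [this]
  refine PosSemidef.mul_mul_conjTranspose_same (PosSemidef.diagonal fun i => ?_) Q
  simpa using hmc i

lemma spectrum_nonneg_of_posSemidef {n : ℕ} {A : Matrix (Fin n) (Fin n) ℂ} (hA : A.PosSemidef)
    {x : ℝ} (hx : x ∈ spectrum ℝ A) : 0 ≤ x := by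
  rw [hA.isHermitian.spectrum_real_eq_range_eigenvalues] at hx
  obtain ⟨i, rfl⟩ := hx
  exact hA.eigenvalues_nonneg i

lemma isHermitian_cfc {n : ℕ} (f : ℝ → ℝ) (A : Matrix (Fin n) (Fin n) ℂ) :
    (cfc f A).IsHermitian :=
  (cfc_predicate f A : IsSelfAdjoint _)

/-- Jensen's inequality for the weights given by the spectral decomposition of `S`. -/
lemma re_dotProduct_cfc_le {n : ℕ} {S : Matrix (Fin n) (Fin n) ℂ} (hS : S.PosSemidef)
    {f : ℝ → ℝ} (hconc : ConcaveOn ℝ (Set.Ici (0 : ℝ)) f) (hf0 : 0 ≤ f 0) (v : Fin n → ℂ)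
    {p : ℝ} (hp : 0 < p) (hv : ∑ i, Complex.normSq (v i) ≤ p) :
    0 ≤ (star v ⬝ᵥ S *ᵥ v).re / p ∧
    (star v ⬝ᵥ cfc f S *ᵥ v).re ≤ f ((star v ⬝ᵥ S *ᵥ v).re / p) * p := by
  obtain ⟨Q, hQ, s, -, hs, hf⟩ := exists_monotone_diagonalization hS.isHermitian
  have hSQ : S = Q * diagonal (fun i => (s i : ℂ)) * Qᴴ := by
    simpa [cfc_id' ℝ S hS.isHermitian.isSelfAdjoint] using hf fun x => x
  have hQ' := Matrix.mem_unitaryGroup_iff.1 hQ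
  rw [star_eq_conjTranspose] at hQ'
  have hs0 : ∀ i, 0 ≤ s i := fun i => spectrum_nonneg_of_posSemidef hS (hs i)
  rw [hf, re_dotProduct_diagonalization]
  have hSv : (star v ⬝ᵥ S *ᵥ v).re = ∑ i, s i * Complex.normSq ((Qᴴ *ᵥ v) i) := by
    conv_lhs => rw [hSQ]
    rw [re_dotProduct_diagonalization]
  rw [hSv]
  rw [← sum_normSq_unitary_mulVec (U := Qᴴ) (by simpa using hQ')] at hv
  set w : Fin n → ℝ := fun i => Complex.normSq ((Qᴴ *ᵥ v) i) / p with hw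
  have hw0 : ∀ i, 0 ≤ w i := fun i => div_nonneg (Complex.normSq_nonneg _) hp.le
  have hwn : ∀ i, Complex.normSq ((Qᴴ *ᵥ v) i) = w i * p := fun i => by
    simp [hw, div_mul_cancel₀ _ hp.ne']
  simp_rw [hwn] at hv ⊢
  rw [← Finset.sum_mul] at hv
  have hw1 : ∑ i, w i ≤ 1 := by
    by_contra! h
    nlinarith
  have e1 : ∑ i, s i * (w i * p) = (∑ i, w i * s i) * p := by
    rw [Finset.sum_mul]; exact Finset.sum_congr rfl fun i _ => by ring
  have e2 : ∑ i, f (s i) * (w i * p) = (∑ i, w i * f (s i)) * p := by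
    rw [Finset.sum_mul]; exact Finset.sum_congr rfl fun i _ => by ring
  rw [e1, e2, mul_div_cancel_right₀ _ hp.ne']
  refine ⟨Finset.sum_nonneg fun i _ => mul_nonneg (hw0 i) (hs0 i),
    mul_le_mul_of_nonneg_right ?_ hp.le⟩
  have hJ := hconc.le_map_sum (t := (Finset.univ : Finset (Option (Fin n))))
    (w := fun o => o.elim (1 - ∑ i, w i) w) (p := fun o => o.elim 0 s)
    (by rintro (_ | i) -
        · simpa using hw1
        · exact hw0 i)
    (by simp [Fintype.sum_option])
    (by rintro (_ | i) -
        · simp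
        · exact hs0 i)
  simp only [Fintype.sum_option, Option.elim, smul_eq_mul, mul_zero, zero_add] at hJ
  have : 0 ≤ (1 - ∑ i, w i) * f 0 := mul_nonneg (by linarith) hf0
  linarith

lemma posSemidef_one_sub_mul_conjTranspose {n : ℕ} {X : Matrix (Fin n) (Fin n) ℂ}
    (hX : (1 - Xᴴ * X).PosSemidef) : (1 - X * Xᴴ).PosSemidef := by
  let _ : Invertible (1 : Matrix (Fin n) (Fin n) ℂ) := invertibleOne
  have h1 := PosDef.fromBlocks₁₁ (A := (1 : Matrix (Fin n) (Fin n) ℂ)) X 1 PosDef.one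
  have h2 := PosDef.fromBlocks₂₂ (1 : Matrix (Fin n) (Fin n) ℂ) X
    (D := (1 : Matrix (Fin n) (Fin n) ℂ)) PosDef.one
  simp only [inv_one, Matrix.mul_one] at h1 h2
  exact h2.1 (h1.2 hX)

/-- Jensen's operator inequality up to a unitary: compressing `f S` by a contraction is
dominated by a unitary conjugate of `f` of the compression. -/
lemma exists_unitary_contraction_cfc_le {n : ℕ} {S X : Matrix (Fin n) (Fin n) ℂ}
    (hS : S.PosSemidef) (hX : (1 - X * Xᴴ).PosSemidef) {f : ℝ → ℝ}
    (hconc : ConcaveOn ℝ (Set.Ici (0 : ℝ)) f)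
    (hmono : MonotoneOn f (Set.Ici (0 : ℝ)) ∨ AntitoneOn f (Set.Ici (0 : ℝ)))
    (hf0 : 0 ≤ f 0) :
    ∃ U ∈ Matrix.unitaryGroup (Fin n) ℂ,
      (U * cfc f (X * S * Xᴴ) * Uᴴ - X * cfc f S * Xᴴ).PosSemidef := by
  have hT : (X * S * Xᴴ).PosSemidef := hS.mul_mul_conjTranspose_same X
  obtain ⟨W, hW, t, ht, hts, hf⟩ : ∃ W ∈ Matrix.unitaryGroup (Fin n) ℂ, ∃ t : Fin n → ℝ,
      (MonotoneOn f (Set.Ici (0 : ℝ)) ∧ Antitone t ∨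
        AntitoneOn f (Set.Ici (0 : ℝ)) ∧ Monotone t) ∧
      (∀ i, t i ∈ spectrum ℝ (X * S * Xᴴ)) ∧
      ∀ f : ℝ → ℝ, cfc f (X * S * Xᴴ) =
        W * diagonal (fun i => ((f (t i) : ℝ) : ℂ)) * Wᴴ := by
    rcases hmono with h | h
    · obtain ⟨W, hW, t, ht, h'⟩ := exists_antitone_diagonalization hT.isHermitian
      exact ⟨W, hW, t, Or.inl ⟨h, ht⟩, h'⟩
    · obtain ⟨W, hW, t, ht, h'⟩ := exists_monotone_diagonalization hT.isHermitian
      exact ⟨W, hW, t, Or.inr ⟨h, ht⟩, h'⟩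
  have hTW : X * S * Xᴴ = W * diagonal (fun i => (t i : ℂ)) * Wᴴ := by
    simpa [cfc_id' ℝ (X * S * Xᴴ) hT.isHermitian.isSelfAdjoint] using hf fun x => x
  have ht0 : ∀ i, 0 ≤ t i := fun i => spectrum_nonneg_of_posSemidef hT (hts i)
  have hW' := Matrix.mem_unitaryGroup_iff'.1 hW
  rw [star_eq_conjTranspose] at hW'
  have hM : (X * cfc f S * Xᴴ).IsHermitian :=
    isHermitian_mul_mul_conjTranspose X (isHermitian_cfc f S)
  obtain ⟨Q, hQ, hQM⟩ := exists_unitary_conj_diagonal_ge hM hW (fun i => f (t i)) (by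
    intro k b hb
    rcases (Finset.sum_nonneg fun i _ => Complex.normSq_nonneg (b i) :
      0 ≤ ∑ i, Complex.normSq (b i)).eq_or_lt with h0 | hp
    · have : b = 0 := by
        ext i
        have := (Finset.sum_eq_zero_iff_of_nonneg fun i _ => Complex.normSq_nonneg (b i)).1
          h0.symm i (Finset.mem_univ _)
        simpa using this
      simp [this]
    have hv : ∑ i, Complex.normSq ((Xᴴ *ᵥ (W *ᵥ b)) i) ≤ ∑ i, Complex.normSq (b i) := by
      rw [← sum_normSq_unitary_mulVec hW' b, sum_normSq_eq_re_dotProduct,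
        sum_normSq_eq_re_dotProduct]
      have h1 := hX.re_dotProduct_nonneg (W *ᵥ b)
      have h2 := star_dotProduct_conj_mulVec X 1 (W *ᵥ b)
      rw [Matrix.mul_one, one_mulVec] at h2
      rw [← h2]
      rw [sub_mulVec, dotProduct_sub, one_mulVec] at h1
      simpa using h1
    obtain ⟨h1, h2⟩ := re_dotProduct_cfc_le hS hconc hf0 _ hp hv
    rw [star_dotProduct_conj_mulVec]
    refine h2.trans (mul_le_mul_of_nonneg_right ?_ hp.le)
    rw [← star_dotProduct_conj_mulVec, hTW, re_dotProduct_diagonalization, mulVec_mulVec, hW',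
      one_mulVec] at h1 ⊢
    rcases ht with ⟨hf, ht⟩ | ⟨hf, ht⟩
    · refine hf h1 (ht0 k) ((div_le_iff₀ hp).2 ?_)
      rw [Finset.mul_sum]
      refine Finset.sum_le_sum fun i _ => ?_
      rcases lt_or_ge i k with hi | hi
      · simp [hb i hi]
      · exact mul_le_mul_of_nonneg_right (ht hi) (Complex.normSq_nonneg _)
    · refine hf (ht0 k) h1 ((le_div_iff₀ hp).2 ?_)
      rw [Finset.mul_sum]
      refine Finset.sum_le_sum fun i _ => ?_
      rcases lt_or_ge i k with hi | hi
      · simp [hb i hi]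
      · exact mul_le_mul_of_nonneg_right (ht hi) (Complex.normSq_nonneg _))
  refine ⟨Q * Wᴴ, mul_mem hQ (by simpa [star_eq_conjTranspose] using Unitary.star_mem hW), ?_⟩
  convert hQM using 2
  rw [hf, conjTranspose_mul, conjTranspose_conjTranspose]
  calc _ = Q * (Wᴴ * W) * diagonal (fun i => ((f (t i) : ℝ) : ℂ)) * (Wᴴ * W) * Qᴴ := by
        simp only [Matrix.mul_assoc]
    _ = _ := by rw [hW']; simp

/-- `Z Zᴴ` and `Zᴴ Z` are unitarily similar. -/
lemma exists_unitary_conjTranspose_mul_self {n : ℕ} (Z : Matrix (Fin n) (Fin n) ℂ) :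
    ∃ U ∈ Matrix.unitaryGroup (Fin n) ℂ, Zᴴ * Z = U * (Z * Zᴴ) * Uᴴ := by
  have h1 : (Zᴴ * Z).IsHermitian := isHermitian_conjTranspose_mul_self Z
  have h2 : (Z * Zᴴ).IsHermitian := isHermitian_mul_conjTranspose_self Z
  have he : h1.eigenvalues = h2.eigenvalues :=
    (IsHermitian.eigenvalues_eq_eigenvalues_iff h1 h2).2 (charpoly_mul_comm _ _)
  refine ⟨(h1.eigenvectorUnitary * star h2.eigenvectorUnitary :
    Matrix.unitaryGroup (Fin n) ℂ), Subtype.prop _, ?_⟩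
  have e1 := h1.spectral_theorem
  have e2 := h2.conjStarAlgAut_star_eigenvectorUnitary
  rw [he, ← e2, ← Unitary.conjStarAlgAut_mul_apply, Unitary.conjStarAlgAut_apply] at e1
  simpa [star_eq_conjTranspose] using e1

lemma cfc_mul_cfc {n : ℕ} (f g : ℝ → ℝ) (A : Matrix (Fin n) (Fin n) ℂ) :
    cfc f A * cfc g A = cfc (fun x => f x * g x) A :=
  (cfc_mul f g A (A.finite_real_spectrum.continuousOn f)
    (A.finite_real_spectrum.continuousOn g)).symm

lemma concave_subadditive_unitary_orbit_of_map_zero {n : ℕ} {A B : Matrix (Fin n) (Fin n) ℂ}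
    (hA : A.PosSemidef) (hB : B.PosSemidef) {f : ℝ → ℝ}
    (hconc : ConcaveOn ℝ (Set.Ici (0 : ℝ)) f)
    (hmono : MonotoneOn f (Set.Ici (0 : ℝ)) ∨ AntitoneOn f (Set.Ici (0 : ℝ)))
    (hf0 : f 0 = 0) :
    ∃ U ∈ Matrix.unitaryGroup (Fin n) ℂ, ∃ V ∈ Matrix.unitaryGroup (Fin n) ℂ,
      (U * cfc f A * Uᴴ + V * cfc f B * Vᴴ - cfc f (A + B)).PosSemidef := by
  obtain ⟨S, hS⟩ : ∃ S, S = A + B := ⟨_, rfl⟩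
  have hSp : S.PosSemidef := hS ▸ hA.add hB
  have hSsa : IsSelfAdjoint S := hSp.isHermitian.isSelfAdjoint
  obtain ⟨R, hR⟩ : ∃ R, R = cfc (fun x : ℝ => (√x)⁻¹) S := ⟨_, rfl⟩
  obtain ⟨P, hP⟩ : ∃ P, P = cfc (fun x : ℝ => if x = 0 then 0 else 1) S := ⟨_, rfl⟩
  obtain ⟨F, hF⟩ : ∃ F, F = cfc (fun x : ℝ => √|f x|) S := ⟨_, rfl⟩
  have hRh : Rᴴ = R := hR ▸ isHermitian_cfc _ S
  have hPh : Pᴴ = P := hP ▸ isHermitian_cfc _ S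
  have hFh : Fᴴ = F := hF ▸ isHermitian_cfc _ S
  have hSid : cfc (fun x : ℝ => x) S = S := cfc_id' ℝ S hSsa
  have hRSR : R * S * R = P := by
    nth_rw 1 [← hSid]
    rw [hR, hP, cfc_mul_cfc, cfc_mul_cfc]
    refine cfc_congr fun x hx => ?_
    have hx0 := spectrum_nonneg_of_posSemidef hSp hx
    rcases hx0.eq_or_lt with rfl | hx0
    · simp
    · have h1 : √x ≠ 0 := (Real.sqrt_pos.2 hx0).ne'
      have h2 := Real.mul_self_sqrt hx0.le
      simp only [hx0.ne', if_false]
      field_simp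
      rw [sq, h2]
  have hPP : P * P = P := by
    rw [hP, cfc_mul_cfc]; congr 1; ext x; split_ifs <;> simp
  have hSP : S * P = S := by
    nth_rw 1 [← hSid]
    rw [hP, cfc_mul_cfc]
    conv_rhs => rw [← hSid]
    congr 1; ext x; split_ifs with h <;> simp [h]
  have hPF : P * F = F := by
    rw [hP, hF, cfc_mul_cfc]; congr 1; ext x; split_ifs with h <;> simp [h, hf0]
  obtain ⟨ε, hε⟩ : ∃ ε : ℝ, cfc f S = ε • (F * F) := by
    have key : ∀ ε : ℝ, (∀ x, 0 ≤ x → f x = ε * |f x|) → cfc f S = ε • (F * F) := by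
      intro ε h
      rw [hF, cfc_mul_cfc, ← cfc_smul ε _ S (S.finite_real_spectrum.continuousOn _)]
      refine cfc_congr fun x hx => ?_
      simpa [Real.mul_self_sqrt (abs_nonneg _)] using h x (spectrum_nonneg_of_posSemidef hSp hx)
    rcases hmono with h | h
    · refine ⟨1, key 1 fun x hx => ?_⟩
      have := h Set.self_mem_Ici hx hx
      rw [abs_of_nonneg (by linarith), one_mul]
    · refine ⟨-1, key (-1) fun x hx => ?_⟩
      have := h Set.self_mem_Ici hx hx
      rw [abs_of_nonpos (by linarith)]; ring
  have h1P : (1 - P).PosSemidef := by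
    have : 1 - P = (1 - P)ᴴ * (1 - P) := by
      rw [conjTranspose_sub, hPh, conjTranspose_one, Matrix.mul_sub, Matrix.sub_mul 1 P P, hPP]
      simp
    rw [this]; exact posSemidef_conjTranspose_mul_self _
  have hPSP : (1 - P)ᴴ * S * (1 - P) = 0 := by
    rw [Matrix.mul_assoc, Matrix.mul_sub S, hSP]; simp
  have key : ∀ C D : Matrix (Fin n) (Fin n) ℂ, C.PosSemidef → D.PosSemidef → C + D = S →
      ∃ U ∈ Matrix.unitaryGroup (Fin n) ℂ,
        (U * cfc f C * Uᴴ - ε • (F * (R * C * R) * F)).PosSemidef := by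
    intro C D hC hD hCD
    obtain ⟨K, hK⟩ : ∃ K, K = cfc (fun x : ℝ => √x) C := ⟨_, rfl⟩
    have hKh : Kᴴ = K := hK ▸ isHermitian_cfc _ C
    have hKK : K * K = C := by
      rw [hK, cfc_mul_cfc]
      conv_rhs => rw [← cfc_id' ℝ C hC.isHermitian.isSelfAdjoint]
      exact cfc_congr fun x hx => Real.mul_self_sqrt (spectrum_nonneg_of_posSemidef hC hx)
    have hKP : K * P = K := by
      have h1 := hC.conjTranspose_mul_mul_same (1 - P)
      have h2 := hD.conjTranspose_mul_mul_same (1 - P)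
      have h3 : (1 - P)ᴴ * C * (1 - P) + (1 - P)ᴴ * D * (1 - P) = 0 := by
        rw [← Matrix.add_mul, ← Matrix.mul_add, hCD, hPSP]
      have h4 : (1 - P)ᴴ * C * (1 - P) = 0 := by
        rw [← h1.trace_eq_zero_iff]
        have h5 := congrArg trace h3
        rw [trace_add, trace_zero] at h5
        exact ((add_eq_zero_iff_of_nonneg h1.trace_nonneg h2.trace_nonneg).1 h5).1
      have h6 : (K * (1 - P))ᴴ * (K * (1 - P)) = 0 := by
        rw [← h4, ← hKK, conjTranspose_mul, hKh]; simp only [Matrix.mul_assoc]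
      have h7 := conjTranspose_mul_self_eq_zero.1 h6
      rw [Matrix.mul_sub, Matrix.mul_one, sub_eq_zero] at h7
      exact h7.symm
    have hXX : (K * R)ᴴ * (K * R) = R * C * R := by
      rw [conjTranspose_mul, hKh, hRh, ← hKK]; simp only [Matrix.mul_assoc]
    have hX : (1 - (K * R)ᴴ * (K * R)).PosSemidef := by
      have : 1 - (K * R)ᴴ * (K * R) = (1 - P) + Rᴴ * D * R := by
        rw [hXX, ← hRSR, ← hCD, hRh, Matrix.mul_add, Matrix.add_mul]; abel
      rw [this]
      exact h1P.add (hD.conjTranspose_mul_mul_same R)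
    have hXSX : (K * R) * S * (K * R)ᴴ = C := by
      calc _ = K * (R * S * R) * K := by
            rw [conjTranspose_mul, hKh, hRh]; simp only [Matrix.mul_assoc]
        _ = C := by rw [hRSR, hKP, hKK]
    obtain ⟨U, hU, hUp⟩ := exists_unitary_contraction_cfc_le hSp
      (posSemidef_one_sub_mul_conjTranspose hX) hconc hmono hf0.ge
    obtain ⟨V, hV, hVe⟩ := exists_unitary_conjTranspose_mul_self (K * R * F)
    refine ⟨V * U, mul_mem hV hU, ?_⟩
    have e1 : F * (R * C * R) * F = V * (K * R * (F * F) * (K * R)ᴴ) * Vᴴ := by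
      rw [← hXX]
      rw [conjTranspose_mul, hFh] at hVe
      simpa only [Matrix.mul_assoc] using hVe
    rw [hXSX] at hUp
    have := hUp.mul_mul_conjTranspose_same V
    convert this using 1
    rw [e1, hε, Matrix.mul_sub, Matrix.sub_mul, conjTranspose_mul]
    simp only [Matrix.mul_assoc, Matrix.mul_smul, Matrix.smul_mul]
  obtain ⟨U, hU, hUp⟩ := key A B hA hB hS.symm
  obtain ⟨V, hV, hVp⟩ := key B A hB hA (by rw [hS, add_comm])
  refine ⟨U, hU, V, hV, ?_⟩
  convert hUp.add hVp using 1
  have : cfc f (A + B) = ε • (F * (R * A * R) * F) + ε • (F * (R * B * R) * F) := by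
    rw [← hS, hε, ← smul_add, ← Matrix.add_mul, ← Matrix.mul_add, ← Matrix.add_mul,
      ← Matrix.mul_add, ← hS, hRSR, Matrix.mul_assoc, hPF]
  rw [this]; abel

lemma cfc_sub_const_of_isHermitian {n : ℕ} (f : ℝ → ℝ) (c : ℝ) {A : Matrix (Fin n) (Fin n) ℂ}
    (hA : A.IsHermitian) :
    cfc (fun x => f x - c) A = cfc f A - c • (1 : Matrix (Fin n) (Fin n) ℂ) := by
  rw [cfc_sub f (fun _ => c) A (A.finite_real_spectrum.continuousOn _)
    (A.finite_real_spectrum.continuousOn _), cfc_const c A hA.isSelfAdjoint,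
    Algebra.algebraMap_eq_smul_one]

/-- **Subadditivity via unitary orbits (Bourin–Uchiyama).** If `f` is a monotone
concave function on `[0,∞)` with `f(0) ≥ 0` and `A, B` are positive
semidefinite, then `f(A+B) ≤ U f(A) U* + V f(B) V*` for some unitaries `U, V`. -/
theorem concave_subadditive_unitary_orbit {n : ℕ} {A B : Matrix (Fin n) (Fin n) ℂ}
    (hA : A.PosSemidef) (hB : B.PosSemidef) (f : ℝ → ℝ)
    (hconc : ConcaveOn ℝ (Set.Ici (0 : ℝ)) f)
    (hmono : MonotoneOn f (Set.Ici (0 : ℝ)) ∨ AntitoneOn f (Set.Ici (0 : ℝ)))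
    (hf0 : 0 ≤ f 0) :
    ∃ U V : Matrix (Fin n) (Fin n) ℂ,
      U ∈ Matrix.unitaryGroup (Fin n) ℂ ∧ V ∈ Matrix.unitaryGroup (Fin n) ℂ ∧
      (U * cfc f A * Uᴴ + V * cfc f B * Vᴴ - cfc f (A + B)).PosSemidef := by
  obtain ⟨U, hU, V, hV, h⟩ := concave_subadditive_unitary_orbit_of_map_zero hA hB
    (f := fun x => f x - f 0) (hconc.sub (convexOn_const _ (convex_Ici 0)))
    (hmono.imp (fun h x hx y hy hxy => sub_le_sub_right (h hx hy hxy) _)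
      (fun h x hx y hy hxy => sub_le_sub_right (h hx hy hxy) _)) (sub_self _)
  refine ⟨U, V, hU, hV, ?_⟩
  have hc : (f 0 • (1 : Matrix (Fin n) (Fin n) ℂ)).PosSemidef := PosSemidef.one.smul hf0
  convert h.add hc using 1
  rw [Matrix.mem_unitaryGroup_iff, star_eq_conjTranspose] at hU hV
  rw [cfc_sub_const_of_isHermitian f _ hA.isHermitian,
    cfc_sub_const_of_isHermitian f _ hB.isHermitian,
    cfc_sub_const_of_isHermitian f _ (hA.add hB).isHermitian]
  simp only [Matrix.mul_sub, Matrix.sub_mul, Matrix.mul_smul, Matrix.smul_mul, Matrix.mul_one,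
    hU, hV]
  abel
end

section
/- Let g be a monotone convex function on [0,∞) with g(0) ≤ 0, and let A, B be n×n positive semidefinite matrices. Then there exist unitary matrices U, V such that g(A+B) ≥ U g(A) U* + V g(B) V*. -/
open Matrix ComplexOrder

theorem ConvexOn.map_sum_le_sum_div_mul {ι : Type*} [Fintype ι] {g : ℝ → ℝ}
    (hg : ConvexOn ℝ (Set.Ici (0 : ℝ)) g) (hg0 : g 0 ≤ 0) {σ p : ι → ℝ}
    (hσ : ∀ i, 0 ≤ σ i) (hp : ∀ i, 0 ≤ p i) (hz : ∀ i, σ i = 0 → p i = 0)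
    (hsum : ∑ i, p i / σ i ≤ 1) :
    g (∑ i, p i) ≤ ∑ i, g (σ i) / σ i * p i := by
  have h := hg.map_add_sum_le (t := Finset.univ) (w := fun i => p i / σ i) (p := σ)
    (v := 1 - ∑ i, p i / σ i) (q := 0) (fun i _ => div_nonneg (hp i) (hσ i)) (by simp)
    (fun i _ => hσ i) (by linarith) (by simp)
  have e : ∀ i, p i / σ i * σ i = p i := fun i => by
    by_cases h0 : σ i = 0
    · simp [h0, hz i h0]
    · field_simp
  simp only [smul_eq_mul, mul_zero, zero_add, e] at h
  refine h.trans ?_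
  have h1 : (1 - ∑ i, p i / σ i) * g 0 ≤ 0 :=
    mul_nonpos_of_nonneg_of_nonpos (by linarith) hg0
  have h2 : ∑ i, p i / σ i * g (σ i) = ∑ i, g (σ i) / σ i * p i :=
    Finset.sum_congr rfl fun i _ => by ring
  linarith

namespace Matrix

variable {n : Type*} [Fintype n]

theorem re_star_dotProduct_self (v : n → ℂ) : (star v ⬝ᵥ v).re = ∑ i, ‖v i‖ ^ 2 := by
  simp [dotProduct, ← Complex.normSq_eq_norm_sq, Complex.normSq_apply]

theorem IsHermitian.mul_mul_self {K A : Matrix n n ℂ} (hK : K.IsHermitian)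
    (hA : A.IsHermitian) : (K * A * K).IsHermitian := by
  have := isHermitian_conjTranspose_mul_mul K hA
  rwa [hK.eq] at this

theorem exists_unit_mulVec_eq_zero_of_ne [DecidableEq n] (M : Matrix n n ℂ) (i : n) :
    ∃ v : n → ℂ, ∑ k, ‖v k‖ ^ 2 = 1 ∧ ∀ k, k ≠ i → (M *ᵥ v) k = 0 := by
  let L : (n → ℂ) →ₗ[ℂ] ({k // k ≠ i} → ℂ) :=
    (LinearMap.funLeft ℂ ℂ Subtype.val).comp M.mulVecLin
  have hL : LinearMap.ker L ≠ ⊥ := by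
    apply LinearMap.ker_ne_bot_of_finrank_lt
    have : 0 < Fintype.card n := Fintype.card_pos_iff.2 ⟨i⟩
    simp
    omega
  obtain ⟨w, hw, hw0⟩ := Submodule.exists_mem_ne_zero_of_ne_bot hL
  have hpos : 0 < ∑ k, ‖w k‖ ^ 2 := by
    obtain ⟨k, hk⟩ := Function.ne_iff.1 hw0
    exact Finset.sum_pos' (fun _ _ => by positivity)
      ⟨k, Finset.mem_univ k, by have := norm_pos_iff.2 hk; positivity⟩
  refine ⟨((Real.sqrt (∑ k, ‖w k‖ ^ 2))⁻¹ : ℂ) • w, ?_, fun k hk => ?_⟩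
  · simp only [Pi.smul_apply, norm_smul, norm_inv, mul_pow, ← Finset.mul_sum, Complex.norm_real,
      Real.norm_eq_abs, inv_pow, sq_abs, Real.sq_sqrt hpos.le]
    exact inv_mul_cancel₀ hpos.ne'
  · have : (M *ᵥ w) k = 0 := congrFun (LinearMap.mem_ker.1 hw) ⟨k, hk⟩
    rw [mulVec_smul, Pi.smul_apply, this, smul_zero]

theorem norm_mulVec_div_of_mul_conjTranspose_le [DecidableEq n] {σ : n → ℝ} {D : Matrix n n ℂ}
    (h : (diagonal (fun i => (σ i : ℂ)) - D * Dᴴ).PosSemidef) {v : n → ℂ}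
    (hv : ∑ k, ‖v k‖ ^ 2 = 1) :
    (∀ i, σ i = 0 → (D *ᵥ v) i = 0) ∧ ∑ i, ‖(D *ᵥ v) i‖ ^ 2 / σ i ≤ 1 := by
  have key : ∀ z : n → ℂ, ∑ i, ‖(Dᴴ *ᵥ z) i‖ ^ 2 ≤ ∑ i, σ i * ‖z i‖ ^ 2 := fun z => by
    have h1 := (Complex.nonneg_iff.1 (h.dotProduct_mulVec_nonneg z)).1
    have h0 : star z ⬝ᵥ (D * Dᴴ) *ᵥ z = star (Dᴴ *ᵥ z) ⬝ᵥ (Dᴴ *ᵥ z) := by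
      rw [star_mulVec, conjTranspose_conjTranspose, ← dotProduct_mulVec, mulVec_mulVec]
    rw [sub_mulVec, dotProduct_sub, Complex.sub_re, h0, re_star_dotProduct_self] at h1
    have h2 : (star z ⬝ᵥ diagonal (fun i => (σ i : ℂ)) *ᵥ z).re = ∑ i, σ i * ‖z i‖ ^ 2 := by
      simp only [dotProduct, mulVec_diagonal, Complex.re_sum, ← Complex.normSq_eq_norm_sq,
        Complex.normSq_apply]
      refine Finset.sum_congr rfl fun i _ => ?_
      simp
      ring
    linarith
  have cs : ∀ z : n → ℂ, ‖star z ⬝ᵥ D *ᵥ v‖ ^ 2 ≤ ∑ i, σ i * ‖z i‖ ^ 2 := fun z => by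
    refine le_trans ?_ (key z)
    have e : star z ⬝ᵥ D *ᵥ v = star (Dᴴ *ᵥ z) ⬝ᵥ v := by
      rw [star_mulVec, conjTranspose_conjTranspose, dotProduct_mulVec]
    rw [e]
    have h1 : ‖star (Dᴴ *ᵥ z) ⬝ᵥ v‖ ≤ ∑ i, ‖(Dᴴ *ᵥ z) i‖ * ‖v i‖ := by
      refine (norm_sum_le _ _).trans (Finset.sum_le_sum fun i _ => ?_)
      simp
    calc _ ≤ (∑ i, ‖(Dᴴ *ᵥ z) i‖ * ‖v i‖) ^ 2 := by gcongr
      _ ≤ _ := by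
        have := Finset.sum_mul_sq_le_sq_mul_sq Finset.univ (fun i => ‖(Dᴴ *ᵥ z) i‖)
          (fun i => ‖v i‖)
        rwa [hv, mul_one] at this
  refine ⟨fun i hi => ?_, ?_⟩
  · have := cs (Pi.single i 1)
    have e : ∑ k, σ k * ‖(Pi.single i 1 : n → ℂ) k‖ ^ 2 = 0 := by
      refine Finset.sum_eq_zero fun k _ => ?_
      obtain rfl | hk := eq_or_ne k i
      · simp [hi]
      · simp [hk]
    rw [e, Pi.star_single, star_one, single_one_dotProduct] at this
    have h3 : ‖(D *ᵥ v) i‖ ^ 2 = 0 := le_antisymm this (by positivity)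
    simpa using h3
  · set c := D *ᵥ v
    have := cs (fun i => c i / σ i)
    have e1 : star (fun i => c i / (σ i : ℂ)) ⬝ᵥ c = ((∑ i, ‖c i‖ ^ 2 / σ i : ℝ) : ℂ) := by
      simp only [dotProduct, Complex.ofReal_sum]
      refine Finset.sum_congr rfl fun i _ => ?_
      simp [div_mul_eq_mul_div, Complex.conj_mul']
    have e2 : ∑ i, σ i * ‖c i / (σ i : ℂ)‖ ^ 2 = ∑ i, ‖c i‖ ^ 2 / σ i := by
      refine Finset.sum_congr rfl fun i _ => ?_
      by_cases h0 : σ i = 0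
      · simp [h0]
      · rw [norm_div, Complex.norm_real, Real.norm_eq_abs, div_pow, sq_abs]
        field_simp
    rw [e1, e2, Complex.norm_real, Real.norm_eq_abs, sq_abs] at this
    nlinarith

variable [DecidableEq n]

theorem IsHermitian.cfc_eq_mul_diagonal_mul {M : Matrix n n ℂ} (hM : M.IsHermitian)
    (f : ℝ → ℝ) :
    cfc f M = (hM.eigenvectorUnitary : Matrix n n ℂ) *
      diagonal (fun i => (f (hM.eigenvalues i) : ℂ)) * (hM.eigenvectorUnitary : Matrix n n ℂ)ᴴ := by
  rw [hM.cfc_eq]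
  rfl

theorem IsHermitian.eq_mul_diagonal_mul {M : Matrix n n ℂ} (hM : M.IsHermitian) :
    M = (hM.eigenvectorUnitary : Matrix n n ℂ) *
      diagonal (fun i => (hM.eigenvalues i : ℂ)) * (hM.eigenvectorUnitary : Matrix n n ℂ)ᴴ :=
  hM.spectral_theorem

theorem IsHermitian.re_star_dotProduct_cfc_mulVec {M : Matrix n n ℂ} (hM : M.IsHermitian)
    (f : ℝ → ℝ) (v : n → ℂ) :
    (star v ⬝ᵥ cfc f M *ᵥ v).re = ∑ i, f (hM.eigenvalues i) *
      ‖((hM.eigenvectorUnitary : Matrix n n ℂ)ᴴ *ᵥ v) i‖ ^ 2 := by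
  rw [hM.cfc_eq_mul_diagonal_mul, ← mulVec_mulVec, ← mulVec_mulVec, dotProduct_mulVec,
    ← conjTranspose_conjTranspose (hM.eigenvectorUnitary : Matrix n n ℂ), ← star_mulVec,
    conjTranspose_conjTranspose]
  simp only [dotProduct, mulVec_diagonal, Complex.re_sum, ← Complex.normSq_eq_norm_sq,
    Complex.normSq_apply]
  refine Finset.sum_congr rfl fun i _ => ?_
  simp
  ring

theorem IsHermitian.re_star_dotProduct_mulVec {M : Matrix n n ℂ} (hM : M.IsHermitian)
    (v : n → ℂ) :
    (star v ⬝ᵥ M *ᵥ v).re = ∑ i, hM.eigenvalues i *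
      ‖((hM.eigenvectorUnitary : Matrix n n ℂ)ᴴ *ᵥ v) i‖ ^ 2 := by
  have h := hM.re_star_dotProduct_cfc_mulVec id v
  rwa [cfc_id ℝ M hM.isSelfAdjoint] at h

theorem IsHermitian.sum_norm_sq_eigenvectorUnitary {M : Matrix n n ℂ} (hM : M.IsHermitian)
    (v : n → ℂ) :
    ∑ i, ‖((hM.eigenvectorUnitary : Matrix n n ℂ)ᴴ *ᵥ v) i‖ ^ 2 = ∑ i, ‖v i‖ ^ 2 := by
  rw [← re_star_dotProduct_self, star_mulVec, conjTranspose_conjTranspose, ← dotProduct_mulVec,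
    mulVec_mulVec, ← star_eq_conjTranspose, Unitary.mul_star_self_of_mem (SetLike.coe_mem _),
    one_mulVec, re_star_dotProduct_self]

/-- A unit vector separating the `i`-th eigenvalues (in decreasing order) of two Hermitian
matrices. -/
theorem IsHermitian.exists_eigenvalues_le_and_le {P Q : Matrix n n ℂ} (hP : P.IsHermitian)
    (hQ : Q.IsHermitian) (i : n) :
    ∃ v : n → ℂ, ∑ k, ‖v k‖ ^ 2 = 1 ∧ hP.eigenvalues i ≤ (star v ⬝ᵥ P *ᵥ v).re ∧
      (star v ⬝ᵥ Q *ᵥ v).re ≤ hQ.eigenvalues i := by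
  let e : n ≃ Fin (Fintype.card n) := (Fintype.equivOfCardEq (Fintype.card_fin _)).symm
  have anti : ∀ {M : Matrix n n ℂ} (hM : M.IsHermitian) {k l : n}, e k ≤ e l →
      hM.eigenvalues l ≤ hM.eigenvalues k := fun hM _ _ h => hM.eigenvalues₀_antitone h
  obtain ⟨v, hv, hk⟩ := exists_unit_mulVec_eq_zero_of_ne (of fun k l => if e i < e k
    then (hP.eigenvectorUnitary : Matrix n n ℂ)ᴴ k l
    else (hQ.eigenvectorUnitary : Matrix n n ℂ)ᴴ k l) i
  refine ⟨v, hv, ?_, ?_⟩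
  · rw [hP.re_star_dotProduct_mulVec, ← mul_one (hP.eigenvalues i), ← hv,
      ← hP.sum_norm_sq_eigenvectorUnitary v, Finset.mul_sum]
    refine Finset.sum_le_sum fun k _ => ?_
    obtain hlt | hle := lt_or_ge (e i) (e k)
    · have h := hk k (fun h => by simp [h] at hlt)
      simp only [mulVec, dotProduct, of_apply, if_pos hlt] at h
      simp only [mulVec, dotProduct, h]
      simp
    · exact mul_le_mul_of_nonneg_right (anti hP hle) (by positivity)
  · rw [hQ.re_star_dotProduct_mulVec, ← mul_one (hQ.eigenvalues i), ← hv,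
      ← hQ.sum_norm_sq_eigenvectorUnitary v, Finset.mul_sum]
    refine Finset.sum_le_sum fun k _ => ?_
    obtain hlt | hle := lt_or_ge (e k) (e i)
    · have h := hk k (fun h => by simp [h] at hlt)
      simp only [mulVec, dotProduct, of_apply, if_neg hlt.not_gt] at h
      simp only [mulVec, dotProduct, h]
      simp
    · exact mul_le_mul_of_nonneg_right (anti hQ hle) (by positivity)

/-- Jensen's inequality for the compression of `g S` by the contraction `S ^ (-1/2) * C`. -/
theorem PosSemidef.map_quadraticForm_le {S C : Matrix n n ℂ} (hS : S.PosSemidef)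
    (hC : C.IsHermitian) (hle : (S - C * C).PosSemidef) {g : ℝ → ℝ}
    (hg : ConvexOn ℝ (Set.Ici (0 : ℝ)) g) (hg0 : g 0 ≤ 0) {v : n → ℂ}
    (hv : ∑ k, ‖v k‖ ^ 2 = 1) :
    g (star v ⬝ᵥ (C * C) *ᵥ v).re ≤
      (star v ⬝ᵥ (C * cfc (fun x => g x / x) S * C) *ᵥ v).re := by
  have hstar : ∀ X : Matrix n n ℂ, star v ⬝ᵥ (C * X * C) *ᵥ v =
      star (C *ᵥ v) ⬝ᵥ X *ᵥ (C *ᵥ v) := fun X => by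
    rw [star_mulVec, hC.eq, ← dotProduct_mulVec, mulVec_mulVec, mulVec_mulVec, mul_assoc]
  have h1 := hstar 1
  rw [mul_one, one_mulVec] at h1
  rw [h1, hstar, hS.1.re_star_dotProduct_cfc_mulVec, re_star_dotProduct_self,
    ← hS.1.sum_norm_sq_eigenvectorUnitary]
  set W : Matrix n n ℂ := (hS.1.eigenvectorUnitary : Matrix n n ℂ)
  have hW : Wᴴ * W = 1 := Unitary.star_mul_self_of_mem (SetLike.coe_mem _)
  have hD : (diagonal (fun i => (hS.1.eigenvalues i : ℂ)) - (Wᴴ * C) * (Wᴴ * C)ᴴ).PosSemidef := by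
    have h2 := hle.conjTranspose_mul_mul_same W
    have h3 : Wᴴ * S * W = diagonal (fun i => (hS.1.eigenvalues i : ℂ)) := by
      conv_lhs => rw [hS.1.eq_mul_diagonal_mul]
      change Wᴴ * (W * _ * Wᴴ) * W = _
      rw [← mul_assoc, ← mul_assoc, hW, one_mul, mul_assoc, hW, mul_one]
    rw [mul_sub, sub_mul, h3] at h2
    rw [conjTranspose_mul, hC.eq, conjTranspose_conjTranspose]
    simpa only [mul_assoc] using h2
  obtain ⟨ha, hb⟩ := norm_mulVec_div_of_mul_conjTranspose_le hD hv
  rw [← mulVec_mulVec] at ha hb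
  exact hg.map_sum_le_sum_div_mul hg0 hS.eigenvalues_nonneg (fun i => by positivity)
    (fun i hi => by simp [ha i hi]) hb

theorem IsHermitian.exists_unitary_sub_eq {A M : Matrix n n ℂ} (hA : A.IsHermitian)
    (hM : M.IsHermitian) (f : ℝ → ℝ) :
    ∃ U ∈ unitaryGroup n ℂ, ∃ W : Matrix n n ℂ, M - U * cfc f A * Uᴴ =
      W * diagonal (fun i => ((hM.eigenvalues i - f (hA.eigenvalues i) : ℝ) : ℂ)) * Wᴴ := by
  refine ⟨_, (hM.eigenvectorUnitary * star hA.eigenvectorUnitary).2,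
    hM.eigenvectorUnitary, ?_⟩
  set V : Matrix n n ℂ := (hA.eigenvectorUnitary : Matrix n n ℂ) with hV
  set W : Matrix n n ℂ := (hM.eigenvectorUnitary : Matrix n n ℂ) with hW
  have hVV : Vᴴ * V = 1 := Unitary.star_mul_self_of_mem (SetLike.coe_mem _)
  have e : W * Vᴴ * cfc f A * (W * Vᴴ)ᴴ =
      W * diagonal (fun i => (f (hA.eigenvalues i) : ℂ)) * Wᴴ := by
    rw [hA.cfc_eq_mul_diagonal_mul, ← hV, conjTranspose_mul, conjTranspose_conjTranspose]
    calc _ = W * (Vᴴ * V) * diagonal (fun i => (f (hA.eigenvalues i) : ℂ)) * (Vᴴ * V) * Wᴴ := by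
          simp only [mul_assoc]
      _ = _ := by simp only [hVV, mul_one]
  change M - W * Vᴴ * cfc f A * (W * Vᴴ)ᴴ = _
  rw [e]
  conv_lhs => rw [hM.eq_mul_diagonal_mul]
  rw [← hW, ← sub_mul, ← mul_sub, diagonal_sub]
  simp

theorem IsHermitian.exists_unitary_of_le_eigenvalues {A M : Matrix n n ℂ} (hA : A.IsHermitian)
    (hM : M.IsHermitian) {f : ℝ → ℝ} (h : ∀ i, f (hA.eigenvalues i) ≤ hM.eigenvalues i) :
    ∃ U ∈ unitaryGroup n ℂ, (M - U * cfc f A * Uᴴ).PosSemidef := by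
  obtain ⟨U, hU, W, e⟩ := hA.exists_unitary_sub_eq hM f
  refine ⟨U, hU, e ▸ PosSemidef.mul_mul_conjTranspose_same
    (posSemidef_diagonal_iff.2 fun i => ?_) W⟩
  exact Complex.zero_le_real.2 (sub_nonneg.2 (h i))

theorem IsHermitian.exists_unitary_of_eigenvalues_le {A M : Matrix n n ℂ} (hA : A.IsHermitian)
    (hM : M.IsHermitian) {f : ℝ → ℝ} (h : ∀ i, hM.eigenvalues i ≤ f (hA.eigenvalues i)) :
    ∃ U ∈ unitaryGroup n ℂ, (U * cfc f A * Uᴴ - M).PosSemidef := by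
  obtain ⟨U, hU, W, e⟩ := hA.exists_unitary_sub_eq hM f
  refine ⟨U, hU, ?_⟩
  rw [← neg_sub, e, ← neg_mul, ← mul_neg, diagonal_neg]
  refine PosSemidef.mul_mul_conjTranspose_same (posSemidef_diagonal_iff.2 fun i => ?_) W
  rw [← Complex.ofReal_neg]
  exact Complex.zero_le_real.2 (by linarith [h i])

theorem isHermitian_cfc (f : ℝ → ℝ) (M : Matrix n n ℂ) : (cfc f M).IsHermitian :=
  cfc_predicate f M

theorem PosSemidef.spectrum_nonneg {S : Matrix n n ℂ} (hS : S.PosSemidef) {x : ℝ}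
    (hx : x ∈ spectrum ℝ S) : 0 ≤ x := by
  rw [hS.1.spectrum_real_eq_range_eigenvalues] at hx
  obtain ⟨i, rfl⟩ := hx
  exact hS.eigenvalues_nonneg i

theorem cfc_mul_cfc (S : Matrix n n ℂ) (f g : ℝ → ℝ) :
    cfc f S * cfc g S = cfc (fun x => f x * g x) S :=
  (cfc_mul f g S (S.finite_real_spectrum.continuousOn f)
    (S.finite_real_spectrum.continuousOn g)).symm

theorem PosSemidef.cfc_sqrt_mul_self {A : Matrix n n ℂ} (hA : A.PosSemidef) :
    cfc Real.sqrt A * cfc Real.sqrt A = A := by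
  rw [cfc_mul_cfc]
  conv_rhs => rw [← cfc_id ℝ A hA.1.isSelfAdjoint]
  exact cfc_congr fun x hx => Real.mul_self_sqrt (hA.spectrum_nonneg hx)

theorem PosSemidef.cfc_sqrt_div_mul_self {S : Matrix n n ℂ} (hS : S.PosSemidef) {h : ℝ → ℝ}
    (hh : ∀ x, 0 ≤ x → 0 ≤ h x) :
    cfc (fun x => √(h x / x)) S * cfc (fun x => √(h x / x)) S = cfc (fun x => h x / x) S := by
  rw [cfc_mul_cfc]
  refine cfc_congr fun x hx => Real.mul_self_sqrt ?_
  have := hS.spectrum_nonneg hx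
  exact div_nonneg (hh x this) this

theorem PosSemidef.cfc_sqrt_div_mul_mul {S : Matrix n n ℂ} (hS : S.PosSemidef) {h : ℝ → ℝ}
    (hh : ∀ x, 0 ≤ x → 0 ≤ h x) (h0 : h 0 = 0) :
    cfc (fun x => √(h x / x)) S * S * cfc (fun x => √(h x / x)) S = cfc h S := by
  nth_rw 2 [← cfc_id ℝ S hS.1.isSelfAdjoint]
  rw [cfc_mul_cfc, cfc_mul_cfc]
  refine cfc_congr fun x hx => ?_
  have hx := hS.spectrum_nonneg hx
  have h1 := Real.mul_self_sqrt (div_nonneg (hh x hx) hx)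
  obtain rfl | hne := eq_or_ne x 0
  · simp [h0]
  · calc √(h x / x) * id x * √(h x / x) = √(h x / x) * √(h x / x) * x := by simp only [id]; ring
      _ = h x := by rw [h1]; field_simp

theorem PosSemidef.charpoly_cfc_sqrt_div_mul_mul {S A : Matrix n n ℂ} (hS : S.PosSemidef)
    (hA : A.PosSemidef) {h : ℝ → ℝ} (hh : ∀ x, 0 ≤ x → 0 ≤ h x) :
    (cfc (fun x => √(h x / x)) S * A * cfc (fun x => √(h x / x)) S).charpoly =
      (cfc Real.sqrt A * cfc (fun x => h x / x) S * cfc Real.sqrt A).charpoly := by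
  rw [← hS.cfc_sqrt_div_mul_self hh]
  nth_rw 1 [← hA.cfc_sqrt_mul_self]
  set K := cfc (fun x => √(h x / x)) S
  set C := cfc Real.sqrt A
  rw [show K * (C * C) * K = (K * C) * (C * K) by simp only [mul_assoc], charpoly_mul_comm]
  simp only [mul_assoc]

theorem PosSemidef.exists_unitary_le_of_monotoneOn {S A : Matrix n n ℂ} (hS : S.PosSemidef)
    (hA : A.PosSemidef) (hle : (S - A).PosSemidef) {g : ℝ → ℝ}
    (hg : ConvexOn ℝ (Set.Ici (0 : ℝ)) g) (hmono : MonotoneOn g (Set.Ici (0 : ℝ)))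
    (hg0 : g 0 = 0) :
    ∃ U ∈ unitaryGroup n ℂ, (cfc (fun x => √(g x / x)) S * A * cfc (fun x => √(g x / x)) S -
      U * cfc g A * Uᴴ).PosSemidef := by
  have hpos : ∀ x, 0 ≤ x → 0 ≤ g x := fun x hx => hg0 ▸ hmono Set.self_mem_Ici hx hx
  have hM := (isHermitian_cfc (fun x => √(g x / x)) S).mul_mul_self hA.1
  have hT := (isHermitian_cfc Real.sqrt A).mul_mul_self (isHermitian_cfc (fun x => g x / x) S)
  have heig := (hM.eigenvalues_eq_eigenvalues_iff hT).2 (hS.charpoly_cfc_sqrt_div_mul_mul hA hpos)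
  refine hA.1.exists_unitary_of_le_eigenvalues hM fun i => ?_
  obtain ⟨v, hv, h1, h2⟩ := hA.1.exists_eigenvalues_le_and_le hT i
  have hJ := hS.map_quadraticForm_le (isHermitian_cfc Real.sqrt A)
    (by rwa [hA.cfc_sqrt_mul_self]) hg hg0.le hv
  rw [hA.cfc_sqrt_mul_self] at hJ
  rw [heig]
  exact (hmono (hA.eigenvalues_nonneg i) ((hA.eigenvalues_nonneg i).trans h1) h1).trans
    (hJ.trans h2)

theorem PosSemidef.exists_unitary_le_of_antitoneOn {S A : Matrix n n ℂ} (hS : S.PosSemidef)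
    (hA : A.PosSemidef) (hle : (S - A).PosSemidef) {g : ℝ → ℝ}
    (hg : ConvexOn ℝ (Set.Ici (0 : ℝ)) g) (hanti : AntitoneOn g (Set.Ici (0 : ℝ)))
    (hg0 : g 0 = 0) :
    ∃ U ∈ unitaryGroup n ℂ,
      (-(cfc (fun x => √(-g x / x)) S * A * cfc (fun x => √(-g x / x)) S) -
        U * cfc g A * Uᴴ).PosSemidef := by
  have hpos : ∀ x, 0 ≤ x → 0 ≤ -g x := fun x hx =>
    neg_nonneg.2 (hg0 ▸ hanti Set.self_mem_Ici hx hx)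
  have hM := (isHermitian_cfc (fun x => √(-g x / x)) S).mul_mul_self hA.1
  have hT := (isHermitian_cfc Real.sqrt A).mul_mul_self (isHermitian_cfc (fun x => -g x / x) S)
  have heig := (hM.eigenvalues_eq_eigenvalues_iff hT).2
    (hS.charpoly_cfc_sqrt_div_mul_mul hA (h := fun x => -g x) hpos)
  obtain ⟨U, hU, h⟩ := hA.1.exists_unitary_of_eigenvalues_le hM (f := fun x => -g x) fun i => by
    obtain ⟨v, hv, h1, h2⟩ := hT.exists_eigenvalues_le_and_le hA.1 i
    have hJ := hS.map_quadraticForm_le (isHermitian_cfc Real.sqrt A)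
      (by rwa [hA.cfc_sqrt_mul_self]) hg hg0.le hv
    rw [hA.cfc_sqrt_mul_self] at hJ
    simp only [neg_div, cfc_neg, mul_neg, neg_mul, neg_mulVec, dotProduct_neg,
      Complex.neg_re] at h1
    have h3 := hanti (Complex.nonneg_iff.1 (hA.dotProduct_mulVec_nonneg v)).1
      (hA.eigenvalues_nonneg i) h2
    rw [heig]
    simp only [neg_div, cfc_neg, mul_neg, neg_mul]
    linarith
  refine ⟨U, hU, ?_⟩
  rw [cfc_neg] at h
  convert h using 1
  simp only [mul_neg, neg_mul]
  abel

theorem IsHermitian.cfc_eq_cfc_sub_const_add {M : Matrix n n ℂ} (hM : M.IsHermitian) (g : ℝ → ℝ)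
    (c : ℝ) : cfc g M = cfc (fun x => g x - c) M + c • (1 : Matrix n n ℂ) := by
  rw [cfc_sub g (fun _ => c) M (M.finite_real_spectrum.continuousOn g) continuousOn_const,
    cfc_const c M hM.isSelfAdjoint, Algebra.algebraMap_eq_smul_one, sub_add_cancel]

theorem PosSemidef.exists_unitary_superadditive {A B : Matrix n n ℂ} (hA : A.PosSemidef)
    (hB : B.PosSemidef) {g : ℝ → ℝ} (hg : ConvexOn ℝ (Set.Ici (0 : ℝ)) g)
    (hmono : MonotoneOn g (Set.Ici (0 : ℝ)) ∨ AntitoneOn g (Set.Ici (0 : ℝ))) (hg0 : g 0 = 0) :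
    ∃ U ∈ unitaryGroup n ℂ, ∃ V ∈ unitaryGroup n ℂ,
      (cfc g (A + B) - (U * cfc g A * Uᴴ + V * cfc g B * Vᴴ)).PosSemidef := by
  have hS := hA.add hB
  have hleA : (A + B - A).PosSemidef := by rwa [add_sub_cancel_left]
  have hleB : (A + B - B).PosSemidef := by rwa [add_sub_cancel_right]
  obtain hm | hm := hmono
  · obtain ⟨U, hU, h1⟩ := hS.exists_unitary_le_of_monotoneOn hA hleA hg hm hg0
    obtain ⟨V, hV, h2⟩ := hS.exists_unitary_le_of_monotoneOn hB hleB hg hm hg0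
    refine ⟨U, hU, V, hV, ?_⟩
    have hsum := hS.cfc_sqrt_div_mul_mul
      (fun x hx => hg0 ▸ hm Set.self_mem_Ici hx hx : ∀ x, 0 ≤ x → 0 ≤ g x) hg0
    convert h1.add h2 using 1
    rw [← hsum, mul_add, add_mul]
    abel
  · obtain ⟨U, hU, h1⟩ := hS.exists_unitary_le_of_antitoneOn hA hleA hg hm hg0
    obtain ⟨V, hV, h2⟩ := hS.exists_unitary_le_of_antitoneOn hB hleB hg hm hg0
    refine ⟨U, hU, V, hV, ?_⟩
    have hsum := hS.cfc_sqrt_div_mul_mul (h := fun x => -g x)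
      (fun x hx => neg_nonneg.2 (hg0 ▸ hm Set.self_mem_Ici hx hx)) (by simp [hg0])
    rw [cfc_neg, mul_add, add_mul] at hsum
    convert h1.add h2 using 1
    rw [← neg_neg (cfc g (A + B)), ← hsum]
    abel

end Matrix

/-- **Superadditivity via unitary orbits.** If `g` is a monotone convex function
on `[0,∞)` with `g(0) ≤ 0` and `A, B` are positive semidefinite, then
`g(A+B) ≥ U g(A) U* + V g(B) V*` for some unitaries `U, V`. -/
theorem convex_superadditive_unitary_orbit {n : ℕ} {A B : Matrix (Fin n) (Fin n) ℂ}
    (hA : A.PosSemidef) (hB : B.PosSemidef) (g : ℝ → ℝ)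
    (hconv : ConvexOn ℝ (Set.Ici (0 : ℝ)) g)
    (hmono : MonotoneOn g (Set.Ici (0 : ℝ)) ∨ AntitoneOn g (Set.Ici (0 : ℝ)))
    (hg0 : g 0 ≤ 0) :
    ∃ U V : Matrix (Fin n) (Fin n) ℂ,
      U ∈ Matrix.unitaryGroup (Fin n) ℂ ∧ V ∈ Matrix.unitaryGroup (Fin n) ℂ ∧
      (cfc g (A + B) - (U * cfc g A * Uᴴ + V * cfc g B * Vᴴ)).PosSemidef := by
  obtain ⟨U, hU, V, hV, h⟩ := hA.exists_unitary_superadditive hB (g := fun x => g x - g 0)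
    (by simp only [sub_eq_add_neg]; exact hconv.add_const (-g 0))
    (hmono.imp (fun hm x hx y hy hxy => sub_le_sub_right (hm hx hy hxy) _)
      (fun hm x hx y hy hxy => sub_le_sub_right (hm hx hy hxy) _)) (sub_self _)
  refine ⟨U, V, hU, hV, ?_⟩
  have hUU : U * Uᴴ = 1 := Unitary.mul_star_self_of_mem hU
  have hVV : V * Vᴴ = 1 := Unitary.mul_star_self_of_mem hV
  convert h.add (PosSemidef.one.smul (neg_nonneg.2 hg0)) using 1
  rw [(hA.add hB).1.cfc_eq_cfc_sub_const_add g (g 0), hA.1.cfc_eq_cfc_sub_const_add g (g 0),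
    hB.1.cfc_eq_cfc_sub_const_add g (g 0)]
  simp only [mul_add, add_mul, mul_smul_comm, smul_mul_assoc, mul_one, hUU, hVV, neg_smul]
  abel
end

section
/- Let f : [0,∞) → [0,∞) be concave and let A = (a_{i,j}) ∈ M_n(ℂ) be positive semidefinite. Then there exist rank-one orthogonal projections E_1, …, E_n such that f(A) ≤ Σ_{i=1}^n f(a_{i,i}) E_i. In particular Tr f(A) ≤ Σ_{i=1}^n f(a_{i,i}). -/
open Matrix ComplexOrder

namespace Matrix

/-- The diagonal entries of `f(A)` are averages of the values of `f` at the eigenvalues. -/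
theorem IsHermitian.cfc_apply_self {n 𝕜 : Type*} [RCLike 𝕜] [Fintype n] [DecidableEq n]
    {A : Matrix n n 𝕜} (hA : A.IsHermitian) (f : ℝ → ℝ) (i : n) :
    cfc f A i i = ((∑ j, ‖(hA.eigenvectorUnitary : Matrix n n 𝕜) i j‖ ^ 2 *
      f (hA.eigenvalues j) : ℝ) : 𝕜) := by
  rw [hA.cfc_eq, IsHermitian.cfc, Unitary.conjStarAlgAut_apply, mul_apply, RCLike.ofReal_sum]
  refine Finset.sum_congr rfl fun j _ => ?_
  rw [mul_diagonal, star_apply, RCLike.ofReal_mul, RCLike.ofReal_pow, ← RCLike.mul_conj]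
  simp only [Function.comp_apply, RCLike.star_def]
  ring

theorem sum_norm_sq_row_of_mem_unitaryGroup {n 𝕜 : Type*} [RCLike 𝕜] [Fintype n] [DecidableEq n]
    {U : Matrix n n 𝕜} (hU : U ∈ unitaryGroup n 𝕜) (i : n) :
    ∑ j, ‖U i j‖ ^ 2 = 1 := by
  have h : (U * star U) i i = 1 := by rw [mem_unitaryGroup_iff.mp hU, one_apply_eq]
  rw [mul_apply] at h
  simp only [star_apply, RCLike.star_def, RCLike.mul_conj] at h
  exact_mod_cast h

/-- **Jensen's inequality** for the diagonal entries of `f(A)`. -/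
theorem PosSemidef.re_cfc_apply_self_le {n 𝕜 : Type*} [RCLike 𝕜] [Fintype n] [DecidableEq n]
    {A : Matrix n n 𝕜} (hA : A.PosSemidef) {f : ℝ → ℝ} (hf : ConcaveOn ℝ (Set.Ici 0) f) (i : n) :
    RCLike.re (cfc f A i i) ≤ f (RCLike.re (A i i)) := by
  have hid : A i i = cfc (fun x : ℝ => x) A i i := by
    rw [cfc_id' ℝ A hA.isHermitian.isSelfAdjoint]
  rw [hid, hA.isHermitian.cfc_apply_self, hA.isHermitian.cfc_apply_self, RCLike.ofReal_re,
    RCLike.ofReal_re]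
  exact hf.le_map_sum (fun j _ => sq_nonneg _)
    (sum_norm_sq_row_of_mem_unitaryGroup hA.isHermitian.eigenvectorUnitary.2 i)
    fun j _ => hA.eigenvalues_nonneg j

theorem exists_rank_one_projection_vecMulVec_star_of_ne_zero {n 𝕜 : Type*} [RCLike 𝕜] [Fintype n]
    {v : n → 𝕜} (hv : v ≠ 0) :
    ∃ E : Matrix n n 𝕜, E.IsHermitian ∧ E * E = E ∧ E.rank = 1 ∧
      vecMulVec v (star v) = (v ⬝ᵥ star v) • E := by
  have hc : v ⬝ᵥ star v ≠ 0 := by rwa [Ne, dotProduct_self_star_eq_zero]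
  refine ⟨(v ⬝ᵥ star v)⁻¹ • vecMulVec v (star v), ?_, ?_, ?_, ?_⟩
  · rw [IsHermitian, conjTranspose_smul, conjTranspose_vecMulVec, star_star, star_inv₀,
      ← dotProduct_star, dotProduct_comm]
  · rw [smul_mul_smul_comm, vecMulVec_mul_vecMulVec, dotProduct_comm (star v), vecMulVec_smul,
      smul_smul, mul_assoc, inv_mul_cancel₀ hc, mul_one]
  · rw [← smul_vecMulVec]
    refine le_antisymm (rank_vecMulVec_le _ _) (Nat.one_le_iff_ne_zero.mpr fun h => hv ?_)
    rw [rank, Submodule.finrank_eq_zero, LinearMap.range_eq_bot] at h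
    have hvv := LinearMap.congr_fun h v
    rwa [mulVecLin_apply, vecMulVec_mulVec, dotProduct_comm, op_smul_eq_smul, smul_smul,
      mul_inv_cancel₀ hc, one_smul] at hvv
  · rw [smul_smul, mul_inv_cancel₀ hc, one_smul]

/-- Every `v v*` is a multiple of a rank-one orthogonal projection, even when `v = 0`. -/
theorem exists_rank_one_projection_vecMulVec_star {n 𝕜 : Type*} [RCLike 𝕜] [Fintype n]
    [Nonempty n] (v : n → 𝕜) :
    ∃ E : Matrix n n 𝕜, E.IsHermitian ∧ E * E = E ∧ E.rank = 1 ∧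
      vecMulVec v (star v) = (v ⬝ᵥ star v) • E := by
  obtain rfl | hv := eq_or_ne v 0
  · obtain ⟨E, hEH, hEE, hEr, -⟩ :=
      exists_rank_one_projection_vecMulVec_star_of_ne_zero (one_ne_zero : (1 : n → 𝕜) ≠ 0)
    exact ⟨E, hEH, hEE, hEr, by simp⟩
  · exact exists_rank_one_projection_vecMulVec_star_of_ne_zero hv

theorem mul_conjTranspose_eq_sum_vecMulVec {m n R : Type*} [Fintype n] [NonUnitalNonAssocSemiring R]
    [StarRing R] (S : Matrix m n R) :
    S * Sᴴ = ∑ j, vecMulVec (S.col j) (star (S.col j)) := by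
  ext i k
  simp [mul_apply, sum_apply, vecMulVec_apply]

/-- A matrix `f(A)` with `f ≥ 0` on the spectrum of `A` is a combination of rank-one orthogonal
projections weighted by its own diagonal entries. -/
theorem exists_cfc_eq_sum_diag_smul_projection {n 𝕜 : Type*} [RCLike 𝕜] [Fintype n]
    [DecidableEq n] {A : Matrix n n 𝕜} {f : ℝ → ℝ}
    (hf : ∀ x ∈ spectrum ℝ A, 0 ≤ f x) :
    ∃ E : n → Matrix n n 𝕜, (∀ i, (E i).IsHermitian) ∧ (∀ i, E i * E i = E i) ∧
      (∀ i, (E i).rank = 1) ∧ cfc f A = ∑ i, cfc f A i i • E i := by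
  set S : Matrix n n 𝕜 := cfc (fun x => √(f x)) A with hS
  have hSH : Sᴴ = S := (cfc_predicate (fun x => √(f x)) A : IsSelfAdjoint S)
  have hcont : ContinuousOn (fun x => √(f x)) (spectrum ℝ A) :=
    A.finite_real_spectrum.continuousOn _
  have hSS : cfc f A = S * Sᴴ := by
    rw [hSH, hS, ← cfc_mul _ _ A hcont hcont]
    exact cfc_congr fun x hx => (Real.mul_self_sqrt (hf x hx)).symm
  have hex : ∀ i, ∃ E : Matrix n n 𝕜, E.IsHermitian ∧ E * E = E ∧ E.rank = 1 ∧
      vecMulVec (S.col i) (star (S.col i)) = (S.col i ⬝ᵥ star (S.col i)) • E := fun i =>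
    haveI : Nonempty n := ⟨i⟩
    exists_rank_one_projection_vecMulVec_star _
  choose E hEH hEE hEr hE using hex
  refine ⟨E, hEH, hEE, hEr, ?_⟩
  have hdiag : ∀ i, cfc f A i i = S.col i ⬝ᵥ star (S.col i) := fun i => by
    have : S * Sᴴ = Sᴴ * S := by rw [hSH]
    rw [hSS, this, mul_apply, dotProduct]
    exact Finset.sum_congr rfl fun k _ => mul_comm _ _
  simp_rw [hdiag, ← hE]
  rw [hSS, mul_conjTranspose_eq_sum_vecMulVec]

end Matrix

/-- **Concave functions and the diagonal (Bourin–Lee).** For a nonnegative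
concave `f` on `[0,∞)` and a positive semidefinite `A = (aᵢⱼ)`, there are
rank-one orthogonal projections `Eᵢ` with `f(A) ≤ Σᵢ f(aᵢᵢ) Eᵢ`; in particular
`Tr f(A) ≤ Σᵢ f(aᵢᵢ)`. -/
theorem concave_le_sum_diag_projections {n : ℕ}
    {A : Matrix (Fin n) (Fin n) ℂ} (hA : A.PosSemidef)
    (f : ℝ → ℝ) (hconc : ConcaveOn ℝ (Set.Ici (0 : ℝ)) f)
    (hf0 : ∀ x : ℝ, 0 ≤ x → 0 ≤ f x) :
    (∃ E : Fin n → Matrix (Fin n) (Fin n) ℂ,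
      (∀ i, (E i).IsHermitian) ∧ (∀ i, E i * E i = E i) ∧ (∀ i, (E i).rank = 1) ∧
      (∑ i, (f ((A i i).re) : ℂ) • E i - cfc f A).PosSemidef) ∧
    (cfc f A).trace.re ≤ ∑ i, f ((A i i).re) := by
  have hnonneg : ∀ x ∈ spectrum ℝ A, 0 ≤ f x := fun x hx => by
    rw [hA.isHermitian.spectrum_real_eq_range_eigenvalues] at hx
    obtain ⟨i, rfl⟩ := hx
    exact hf0 _ (hA.eigenvalues_nonneg i)
  refine ⟨?_, ?_⟩
  · obtain ⟨E, hEH, hEE, hEr, hE⟩ := exists_cfc_eq_sum_diag_smul_projection hnonneg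
    refine ⟨E, hEH, hEE, hEr, ?_⟩
    nth_rewrite 1 [hE]
    rw [← Finset.sum_sub_distrib]
    refine posSemidef_sum _ fun i _ => ?_
    rw [← sub_smul]
    have hEi : (E i).PosSemidef := by
      have := posSemidef_conjTranspose_mul_self (E i)
      rwa [hEH i, hEE i] at this
    refine hEi.smul ?_
    have hJ := hA.re_cfc_apply_self_le hconc i
    rw [hA.isHermitian.cfc_apply_self] at hJ ⊢
    rw [RCLike.ofReal_re] at hJ
    exact sub_nonneg.mpr (Complex.real_le_real.mpr hJ)
  · rw [trace, Complex.re_sum]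
    exact Finset.sum_le_sum fun i _ => hA.re_cfc_apply_self_le hconc i
end

section
/- Let A, B be n×n positive semidefinite matrices, x ∈ (0,1), p ≥ 1, and 0 ≤ q ≤ 1. Then (Tr A^{pq} + Tr B^{pq})^{1/p} ≤ (Tr((xA+(1−x)B)^{pq}))^{1/p} + (Tr(((1−x)A+xB)^{pq}))^{1/p}. -/
open Matrix ComplexOrder

/-- The real part of the quadratic form `u ↦ ⟪u, A u⟫`. -/
noncomputable def reQuadForm {ι : Type*} [Fintype ι] [DecidableEq ι] (A : Matrix ι ι ℂ)
    (u : EuclideanSpace ℂ ι) : ℝ :=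
  (inner ℂ u (A.toEuclideanLin u)).re

section
variable {ι : Type*} [Fintype ι] [DecidableEq ι] {A B S : Matrix ι ι ℂ}

lemma reQuadForm_add (u : EuclideanSpace ℂ ι) :
    reQuadForm (A + B) u = reQuadForm A u + reQuadForm B u := by
  simp [reQuadForm]

lemma reQuadForm_smul (c : ℝ) (u : EuclideanSpace ℂ ι) :
    reQuadForm (c • A) u = c * reQuadForm A u := by
  have h : c • A = (c : ℂ) • A := by ext; simp
  rw [reQuadForm, h, map_smul, LinearMap.smul_apply, inner_smul_right, Complex.re_ofReal_mul,
    reQuadForm]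

lemma reQuadForm_nonneg (hA : A.PosSemidef) (u : EuclideanSpace ℂ ι) :
    0 ≤ reQuadForm A u := by
  have h := hA.re_dotProduct_nonneg u.ofLp
  simpa [reQuadForm, EuclideanSpace.inner_eq_star_dotProduct, toLpLin_apply, dotProduct_comm]
    using h

lemma toEuclideanLin_eigenvectorBasis (hA : A.IsHermitian) (i : ι) :
    A.toEuclideanLin (hA.eigenvectorBasis i) =
      (hA.eigenvalues i : ℂ) • hA.eigenvectorBasis i := by
  ext k
  have := congrFun (hA.mulVec_eigenvectorBasis i) k
  simpa [toLpLin_apply] using this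

lemma reQuadForm_eq_sum (hA : A.IsHermitian) (u : EuclideanSpace ℂ ι) :
    reQuadForm A u = ∑ i, hA.eigenvalues i * ‖inner ℂ (hA.eigenvectorBasis i) u‖ ^ 2 := by
  rw [reQuadForm, ← hA.eigenvectorBasis.sum_inner_mul_inner, Complex.re_sum]
  refine Finset.sum_congr rfl fun i _ => ?_
  rw [← isSymmetric_toEuclideanLin_iff.mpr hA (hA.eigenvectorBasis i) u,
    toEuclideanLin_eigenvectorBasis, inner_smul_left, mul_left_comm, Complex.conj_ofReal,
    ← inner_conj_symm u, Complex.conj_mul', Complex.re_ofReal_mul, ← Complex.ofReal_pow,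
    Complex.ofReal_re]

lemma reQuadForm_eigenvectorBasis (hA : A.IsHermitian) (i : ι) :
    reQuadForm A (hA.eigenvectorBasis i) = hA.eigenvalues i := by
  simp [reQuadForm, toEuclideanLin_eigenvectorBasis]

lemma re_trace_cfc (hA : A.IsHermitian) (f : ℝ → ℝ) :
    (cfc f A).trace.re = ∑ i, f (hA.eigenvalues i) := by
  rw [hA.cfc_eq, IsHermitian.cfc, Unitary.conjStarAlgAut_apply, trace_mul_cycle]
  simp [trace_diagonal]

/-- Peierls' inequality. -/
lemma sum_reQuadForm_le_re_trace_cfc (hA : A.PosSemidef) {f : ℝ → ℝ}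
    (hf : ConvexOn ℝ (Set.Ici 0) f) (b : OrthonormalBasis ι ℂ (EuclideanSpace ℂ ι)) :
    ∑ j, f (reQuadForm A (b j)) ≤ (cfc f A).trace.re := by
  have hle (j : ι) : f (reQuadForm A (b j)) ≤
      ∑ i, ‖inner ℂ (hA.1.eigenvectorBasis i) (b j)‖ ^ 2 * f (hA.1.eigenvalues i) := by
    have h := hf.map_sum_le (t := Finset.univ)
      (w := fun i => ‖inner ℂ (hA.1.eigenvectorBasis i) (b j)‖ ^ 2) (p := hA.1.eigenvalues)
      (fun _ _ => by positivity) (by simp [OrthonormalBasis.sum_sq_norm_inner_right])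
      (fun i _ => hA.eigenvalues_nonneg i)
    simpa [reQuadForm_eq_sum hA.1, mul_comm] using h
  refine (Finset.sum_le_sum fun j _ => hle j).trans_eq ?_
  rw [Finset.sum_comm, re_trace_cfc hA.1]
  simp [← Finset.sum_mul, OrthonormalBasis.sum_sq_norm_inner_left]

lemma re_trace_cfc_add_smul_le (hA : A.PosSemidef) (hB : B.PosSemidef) {f : ℝ → ℝ}
    (hf : ConvexOn ℝ (Set.Ici 0) f) {x y : ℝ} (hx : 0 ≤ x) (hy : 0 ≤ y) (hxy : x + y = 1) :
    (cfc f (x • A + y • B)).trace.re ≤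
      x * (cfc f A).trace.re + y * (cfc f B).trace.re := by
  have hC : (x • A + y • B).PosSemidef := (hA.smul hx).add (hB.smul hy)
  rw [re_trace_cfc hC.1]
  calc ∑ j, f (hC.1.eigenvalues j)
      ≤ ∑ j, (x * f (reQuadForm A (hC.1.eigenvectorBasis j)) +
          y * f (reQuadForm B (hC.1.eigenvectorBasis j))) := by
        refine Finset.sum_le_sum fun j _ => ?_
        rw [← reQuadForm_eigenvectorBasis, reQuadForm_add, reQuadForm_smul, reQuadForm_smul]
        exact hf.2 (reQuadForm_nonneg hA _) (reQuadForm_nonneg hB _) hx hy hxy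
    _ ≤ _ := by
        rw [Finset.sum_add_distrib, ← Finset.mul_sum, ← Finset.mul_sum]
        gcongr <;> exact sum_reQuadForm_le_re_trace_cfc ‹_› hf _

lemma re_trace_cfc_rpow_nonneg (hA : A.PosSemidef) (r : ℝ) :
    0 ≤ (cfc (fun y : ℝ => y ^ r) A).trace.re := by
  rw [re_trace_cfc hA.1]
  exact Finset.sum_nonneg fun i _ => Real.rpow_nonneg (hA.eigenvalues_nonneg i) r

/-- Minkowski's inequality for the Schatten `r`-norm of positive semidefinite matrices. -/
lemma re_trace_cfc_rpow_add_rpow_inv_le (hA : A.PosSemidef) (hB : B.PosSemidef) {r : ℝ}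
    (hr : 1 ≤ r) :
    (cfc (fun y : ℝ => y ^ r) (A + B)).trace.re ^ (1 / r) ≤
      (cfc (fun y : ℝ => y ^ r) A).trace.re ^ (1 / r) +
        (cfc (fun y : ℝ => y ^ r) B).trace.re ^ (1 / r) := by
  have hC := hA.add hB
  have hsum : (cfc (fun y : ℝ => y ^ r) (A + B)).trace.re =
      ∑ j, (reQuadForm A (hC.1.eigenvectorBasis j) +
        reQuadForm B (hC.1.eigenvectorBasis j)) ^ r := by
    simp_rw [re_trace_cfc hC.1, ← reQuadForm_add, reQuadForm_eigenvectorBasis]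
  rw [hsum]
  refine (Real.Lp_add_le_of_nonneg _ hr (fun j _ => reQuadForm_nonneg hA _)
    fun j _ => reQuadForm_nonneg hB _).trans ?_
  gcongr
  · exact Finset.sum_nonneg fun j _ => Real.rpow_nonneg (reQuadForm_nonneg hA _) r
  · exact sum_reQuadForm_le_re_trace_cfc hA (convexOn_rpow hr) _
  · exact Finset.sum_nonneg fun j _ => Real.rpow_nonneg (reQuadForm_nonneg hB _) r
  · exact sum_reQuadForm_le_re_trace_cfc hB (convexOn_rpow hr) _

/-- If `A ≤ S` then `α ⟪v, S⁻¹ v⟫ ≤ 1` for every unit eigenvector `v` of `A` with eigenvalue `α`,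
where `S⁻¹` denotes the pseudo-inverse. -/
lemma eigenvalue_mul_sum_div_le_one (hA : A.PosSemidef) (hS : S.PosSemidef)
    (h : ∀ u, reQuadForm A u ≤ reQuadForm S u) (i : ι) :
    ∑ j, hA.1.eigenvalues i *
      ‖inner ℂ (hA.1.eigenvectorBasis i) (hS.1.eigenvectorBasis j)‖ ^ 2 /
        hS.1.eigenvalues j ≤ 1 := by
  set v := hA.1.eigenvectorBasis
  set u := hS.1.eigenvectorBasis
  set s := hS.1.eigenvalues
  set t : ℝ := ∑ j, ‖inner ℂ (v i) (u j)‖ ^ 2 / s j with ht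
  set w : EuclideanSpace ℂ ι := ∑ j, (inner ℂ (u j) (v i) / s j : ℂ) • u j with hw
  have ht0 : 0 ≤ t := Finset.sum_nonneg fun j _ =>
    div_nonneg (by positivity) (hS.eigenvalues_nonneg j)
  have huw (j : ι) : inner ℂ (u j) w = (inner ℂ (u j) (v i) / s j : ℂ) := by
    rw [hw]; exact u.orthonormal.inner_right_fintype _ j
  have hSw : reQuadForm S w = t := by
    rw [reQuadForm_eq_sum hS.1]
    refine Finset.sum_congr rfl fun j _ => ?_
    rw [huw, norm_div, norm_inner_symm, Complex.norm_real, div_pow, Real.norm_eq_abs, sq_abs]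
    change s j * _ = _
    rcases eq_or_ne (s j) 0 with h0 | h0
    · simp [h0]
    · field_simp
  have hvw : inner ℂ (v i) w = (t : ℂ) := by
    rw [hw, inner_sum, ht, Complex.ofReal_sum]
    refine Finset.sum_congr rfl fun j _ => ?_
    rw [inner_smul_right, div_mul_eq_mul_div, ← inner_conj_symm, Complex.conj_mul']
    push_cast
    rfl
  have hAw : hA.1.eigenvalues i * t ^ 2 ≤ reQuadForm A w := by
    rw [reQuadForm_eq_sum hA.1]
    refine le_trans (le_of_eq ?_) (Finset.single_le_sum (fun k _ =>
      mul_nonneg (hA.eigenvalues_nonneg k) (sq_nonneg _)) (Finset.mem_univ i))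
    rw [show inner ℂ (hA.1.eigenvectorBasis i) w = (t : ℂ) from hvw]
    simp
  have hle : hA.1.eigenvalues i * t ^ 2 ≤ t := hAw.trans ((h w).trans_eq hSw)
  have : ∑ j, hA.1.eigenvalues i * ‖inner ℂ (v i) (u j)‖ ^ 2 / s j =
      hA.1.eigenvalues i * t := by
    simp_rw [ht, Finset.mul_sum, mul_div_assoc]
  rw [this]
  rcases ht0.eq_or_lt with h0 | h0
  · simp [← h0]
  · nlinarith

lemma sum_eigenvalues_rpow_le (hA : A.PosSemidef) (hS : S.PosSemidef)
    (h : ∀ u, reQuadForm A u ≤ reQuadForm S u) {r : ℝ} (hr : 1 ≤ r) :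
    ∑ i, hA.1.eigenvalues i ^ r ≤
      ∑ j, reQuadForm A (hS.1.eigenvectorBasis j) / hS.1.eigenvalues j *
        hS.1.eigenvalues j ^ r := by
  have hr0 : r ≠ 0 := by positivity
  set v := hA.1.eigenvectorBasis with hv
  set u := hS.1.eigenvectorBasis with hu
  set s := hS.1.eigenvalues with hs
  set α := hA.1.eigenvalues with hα
  have hα0 : ∀ i, 0 ≤ α i := hA.eigenvalues_nonneg
  have hs0 : ∀ j, 0 ≤ s j := hS.eigenvalues_nonneg
  have hker (i j : ι) (hj : s j = 0) : α i * ‖inner ℂ (v i) (u j)‖ ^ 2 = 0 := by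
    have hle : reQuadForm A (u j) ≤ 0 := by
      simpa only [hu, reQuadForm_eigenvectorBasis, ← hs, hj] using h (u j)
    rw [reQuadForm_eq_sum hA.1] at hle
    refine le_antisymm (le_trans ?_ hle) (mul_nonneg (hα0 i) (sq_nonneg _))
    exact Finset.single_le_sum (f := fun k => α k * ‖inner ℂ (v k) (u j)‖ ^ 2)
      (fun k _ => mul_nonneg (hα0 k) (sq_nonneg _)) (Finset.mem_univ i)
  have hrow (i : ι) : α i ^ r ≤ ∑ j, α i * ‖inner ℂ (v i) (u j)‖ ^ 2 / s j * s j ^ r := by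
    have hJ := (convexOn_rpow hr).map_add_sum_le (t := Finset.univ)
      (w := fun j => α i * ‖inner ℂ (v i) (u j)‖ ^ 2 / s j) (p := s) (v := 1 -
        ∑ j, α i * ‖inner ℂ (v i) (u j)‖ ^ 2 / s j) (q := 0)
      (fun j _ => div_nonneg (mul_nonneg (hα0 i) (sq_nonneg _)) (hs0 j)) (by ring)
      (fun j _ => hs0 j) (sub_nonneg.mpr (eigenvalue_mul_sum_div_le_one hA hS h i)) (by simp)
    have hmean : ∑ j, α i * ‖inner ℂ (v i) (u j)‖ ^ 2 / s j * s j = α i := by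
      have : ∑ j, α i * ‖inner ℂ (v i) (u j)‖ ^ 2 = α i := by
        simp [← Finset.mul_sum, OrthonormalBasis.sum_sq_norm_inner_left]
      conv_rhs => rw [← this]
      exact Finset.sum_congr rfl fun j _ => div_mul_cancel_of_imp (hker i j)
    simpa [hmean, Real.zero_rpow hr0] using hJ
  refine (Finset.sum_le_sum fun i _ => hrow i).trans_eq ?_
  rw [Finset.sum_comm]
  refine Finset.sum_congr rfl fun j _ => ?_
  rw [reQuadForm_eq_sum hA.1, ← Finset.sum_mul, ← Finset.sum_div]

/-- McCarthy's inequality. -/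
lemma re_trace_cfc_rpow_add_le (hA : A.PosSemidef) (hB : B.PosSemidef) {r : ℝ} (hr : 1 ≤ r) :
    (cfc (fun y : ℝ => y ^ r) A).trace.re + (cfc (fun y : ℝ => y ^ r) B).trace.re ≤
      (cfc (fun y : ℝ => y ^ r) (A + B)).trace.re := by
  have hS := hA.add hB
  have hr0 : r ≠ 0 := by positivity
  rw [re_trace_cfc hA.1, re_trace_cfc hB.1, re_trace_cfc hS.1]
  refine (add_le_add (sum_eigenvalues_rpow_le hA hS (fun u => ?_) hr)
    (sum_eigenvalues_rpow_le hB hS (fun u => ?_) hr)).trans_eq ?_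
  · simpa [reQuadForm_add] using reQuadForm_nonneg hB u
  · simpa [reQuadForm_add] using reQuadForm_nonneg hA u
  · rw [← Finset.sum_add_distrib]
    refine Finset.sum_congr rfl fun j _ => ?_
    rw [← add_mul, ← add_div, ← reQuadForm_add, reQuadForm_eigenvectorBasis]
    rcases eq_or_ne (hS.1.eigenvalues j) 0 with h0 | h0
    · simp [h0, Real.zero_rpow hr0]
    · rw [div_self h0, one_mul]

/-- Concavity of `A ↦ Tr A ^ r` for `0 ≤ r ≤ 1`. -/
lemma le_re_trace_cfc_rpow_add_smul (hA : A.PosSemidef) (hB : B.PosSemidef) {r : ℝ}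
    (hr0 : 0 ≤ r) (hr1 : r ≤ 1) {x y : ℝ} (hx : 0 ≤ x) (hy : 0 ≤ y) (hxy : x + y = 1) :
    x * (cfc (fun y : ℝ => y ^ r) A).trace.re + y * (cfc (fun y : ℝ => y ^ r) B).trace.re ≤
      (cfc (fun y : ℝ => y ^ r) (x • A + y • B)).trace.re := by
  have h := re_trace_cfc_add_smul_le hA hB (Real.concaveOn_rpow hr0 hr1).neg hx hy hxy
  have hneg (M : Matrix ι ι ℂ) : (cfc (-fun y : ℝ => y ^ r) M).trace.re =
      -(cfc (fun y : ℝ => y ^ r) M).trace.re := by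
    rw [show (-fun y : ℝ => y ^ r) = fun y : ℝ => -(y ^ r) from rfl, cfc_neg]
    simp
  simp only [hneg] at h
  linarith

end

/-- **Schatten-type trace inequality around Hermite–Hadamard (Bourin–Lee).**
For positive semidefinite `A, B`, `0 < x < 1`, `p ≥ 1` and `0 ≤ q ≤ 1`,
`(Tr A^{pq} + Tr B^{pq})^{1/p} ≤ (Tr((xA+(1−x)B)^{pq}))^{1/p}
  + (Tr(((1−x)A+xB)^{pq}))^{1/p}`. -/
theorem trace_rpow_hermite_hadamard {n : ℕ}
    {A B : Matrix (Fin n) (Fin n) ℂ} (hA : A.PosSemidef) (hB : B.PosSemidef)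
    {x : ℝ} (hx0 : 0 < x) (hx1 : x < 1)
    {p q : ℝ} (hp : 1 ≤ p) (hq0 : 0 ≤ q) (hq1 : q ≤ 1) :
    ((cfc (fun y : ℝ => y ^ (p * q)) A).trace.re +
        (cfc (fun y : ℝ => y ^ (p * q)) B).trace.re) ^ (1 / p) ≤
      (cfc (fun y : ℝ => y ^ (p * q)) (x • A + (1 - x) • B)).trace.re ^ (1 / p) +
      (cfc (fun y : ℝ => y ^ (p * q)) ((1 - x) • A + x • B)).trace.re ^ (1 / p) := by
  have hx0' : 0 ≤ x := hx0.le
  have hx1' : 0 ≤ 1 - x := by linarith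
  have hC : (x • A + (1 - x) • B).PosSemidef := (hA.smul hx0').add (hB.smul hx1')
  have hD : ((1 - x) • A + x • B).PosSemidef := (hA.smul hx1').add (hB.smul hx0')
  have hp0 : 0 < p := by linarith
  have hAB : A + B = (x • A + (1 - x) • B) + ((1 - x) • A + x • B) := by module
  have ha := re_trace_cfc_rpow_nonneg hA (p * q)
  have hb := re_trace_cfc_rpow_nonneg hB (p * q)
  have hc := re_trace_cfc_rpow_nonneg hC (p * q)
  have hd := re_trace_cfc_rpow_nonneg hD (p * q)
  rcases le_total (p * q) 1 with hr | hr
  · have hr0 : 0 ≤ p * q := by positivity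
    refine le_trans (Real.rpow_le_rpow (by positivity) ?_ (by positivity))
      (Real.rpow_add_le_add_rpow hc hd (by positivity) ((div_le_one hp0).mpr hp))
    have h1 := le_re_trace_cfc_rpow_add_smul hA hB hr0 hr hx0' hx1' (by ring)
    have h2 := le_re_trace_cfc_rpow_add_smul hA hB hr0 hr hx1' hx0' (by ring)
    linarith
  · have hq : q ≠ 0 := by rintro rfl; norm_num at hr
    have hpow {t : ℝ} (ht : 0 ≤ t) : t ^ (1 / p) = (t ^ (1 / (p * q))) ^ q := by
      rw [← Real.rpow_mul ht]
      congr 1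
      field_simp
    rw [hpow (add_nonneg ha hb), hpow hc, hpow hd]
    refine le_trans (Real.rpow_le_rpow (by positivity) ?_ hq0)
      (Real.rpow_add_le_add_rpow (by positivity) (by positivity) hq0 hq1)
    refine le_trans (Real.rpow_le_rpow (by positivity)
      (re_trace_cfc_rpow_add_le hA hB hr) (by positivity)) ?_
    rw [hAB]
    exact re_trace_cfc_rpow_add_rpow_inv_le hC hD hr
end
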